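/- Let I be a set, and for every ι ∈ I let θ_ι : A_ι → D_ι be a unital completely positive map between unital C*-algebras, let φ_ι and ψ_ι be states on A_ι and D_ι respectively, each having faithful GNS representation, and suppose ψ_ι∘θ_ι = φ_ι. Let (A,φ) = *_{ι∈I}(A_ι,φ_ι) and (D,ψ) = *_{ι∈I}(D_ι,ψ_ι) be the reduced free products of C*-algebras. Then there is a unital completely positive map θ : A → D such that the restriction of θ to the canonical copy of A_ι in A equals θ_ι followed by the canonical embedding D_ι ↪ D for every ι ∈ I, and such that θ(a₁a₂⋯aₙ) = θ(a₁)θ(a₂)⋯θ(aₙ) whenever a_j ∈ A_{ι_j} ∩ ker φ_{ι_j} for some ι_j ∈ I with ι₁ ≠ ι₂, …, ι_{n−1} ≠ ιₙ. -/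

import Mathlib

noncomputable section

/-- A conditional expectation from a unital C⋆-algebra `A` onto a unital C⋆-subalgebra
(the range of the unital embedding `j : B →⋆ₐ[ℂ] A`): a positive, `B`–`B`-bimodule,
idempotent (i.e. restricting to the identity on `B`) contraction. -/
structure IsCondExp {B A : Type*} [CStarAlgebra B] [CStarAlgebra A]
    (j : B →⋆ₐ[ℂ] A) (E : A →ₗ[ℂ] B) : Prop where
  injective : Function.Injective j
  left_inverse : ∀ b : B, E (j b) = b
  bimodule : ∀ (b₁ b₂ : B) (a : A), E (j b₁ * a * j b₂) = b₁ * E a * b₂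
  positive : ∀ a : A, ∃ b : B, E (star a * a) = star b * b
  contractive : ∀ a : A, ‖E a‖ ≤ ‖a‖

/-- The GNS representation of a conditional expectation `E : A → B` (i.e. the left action
of `A` on the Hilbert `B`-module `L²(A,E)` obtained from `A` by separation and completion
with respect to the `B`-valued inner product `⟨a₁, a₂⟩ = E (a₁⋆ * a₂)`) is faithful:
`a` acts as zero on the image of `A` in `L²(A,E)` only if `a = 0`. -/
def FaithfulGNS {B A : Type*} [CStarAlgebra B] [CStarAlgebra A] (E : A →ₗ[ℂ] B) : Prop :=
  ∀ a : A, (∀ x : A, E (star (a * x) * (a * x)) = 0) → a = 0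

/-- `(C, jC, emb, E)` is the reduced amalgamated free product of the unital C⋆-algebras
`A i` over `B` with respect to the conditional expectations `φ i : A i → B` (each having
faithful GNS representation): the `A i` embed into `C` compatibly with the copies of `B`,
`E` is a conditional expectation onto `B` with faithful GNS representation restricting to
`φ i` on each `A i`, the family of copies of the `A i` is free with respect to `E`, and
the copies of the `A i` together generate `C` as a C⋆-algebra.  These properties
characterize the reduced amalgamated free product `(A,φ) = (*_B)_{i ∈ I} (A i, φ i)`
up to canonical isomorphism. -/
structure IsReducedAmalgProd (B : Type*) [CStarAlgebra B] {I : Type*} {A : I → Type*}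
    [∀ i, CStarAlgebra (A i)] (jB : ∀ i, B →⋆ₐ[ℂ] A i) (φ : ∀ i, A i →ₗ[ℂ] B)
    {C : Type*} [CStarAlgebra C] (jC : B →⋆ₐ[ℂ] C) (emb : ∀ i, A i →⋆ₐ[ℂ] C)
    (E : C →ₗ[ℂ] B) : Prop where
  emb_injective : ∀ i, Function.Injective (emb i)
  compat : ∀ i, (emb i).comp (jB i) = jC
  condExp : IsCondExp jC E
  restrict : ∀ i (a : A i), E (emb i a) = φ i a
  faithful : FaithfulGNS E
  free : ∀ (n : ℕ) (ι : Fin (n + 1) → I), (∀ k : Fin n, ι k.castSucc ≠ ι k.succ) →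
    ∀ a : (j : Fin (n + 1)) → A (ι j), (∀ j, φ (ι j) (a j) = 0) →
      E ((List.ofFn fun j => emb (ι j) (a j)).prod) = 0
  generating :
    Dense ((StarAlgebra.adjoin ℂ (⋃ i, Set.range (emb i)) : StarSubalgebra ℂ C) : Set C)

/-- A state on a unital C⋆-algebra `D`, viewed as a conditional expectation onto the
canonical copy of `ℂ` in `D`; in particular it is unital, positive and contractive. -/
def IsState {D : Type*} [CStarAlgebra D] (φ : D →ₗ[ℂ] ℂ) : Prop :=
  IsCondExp (StarAlgHom.ofId ℂ D) φ

/-- A completely positive map between unital C⋆-algebras. -/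
def IsCompletelyPositive {A D : Type*} [CStarAlgebra A] [CStarAlgebra D]
    (θ : A →ₗ[ℂ] D) : Prop :=
  ∀ (n : ℕ) (a : Fin n → A) (c : Fin n → D),
    ∃ d : D, ∑ i, ∑ j, star (c i) * θ (star (a i) * a j) * c j = star d * d

open scoped ComplexOrder InnerProductSpace

section CStar

variable {A C D : Type*} [CStarAlgebra A] [PartialOrder A] [StarOrderedRing A]
  [CStarAlgebra C] [PartialOrder C] [StarOrderedRing C]
  [CStarAlgebra D] [PartialOrder D] [StarOrderedRing D]

namespace PositiveLinearMap

theorem norm_apply_star_mul_le (f : A →ₚ[ℂ] ℂ) (a b : A) :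
    ‖f (star a * b)‖ ≤ ‖f.toPreGNS a‖ * ‖f.toPreGNS b‖ :=
  norm_inner_le_norm (𝕜 := ℂ) (f.toPreGNS a) (f.toPreGNS b)

theorem apply_star_mul_self (f : A →ₚ[ℂ] ℂ) (a : A) :
    f (star a * a) = ((‖f.toPreGNS a‖ ^ 2 : ℝ) : ℂ) := by
  rw [Complex.ofReal_pow, f.preGNS_norm_sq]; simp

theorem norm_toPreGNS_mul_le (f : A →ₚ[ℂ] ℂ) (x a : A) :
    ‖f.toPreGNS (x * a)‖ ≤ ‖x‖ * ‖f.toPreGNS a‖ :=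
  (f.leftMulMapPreGNS x).le_of_opNorm_le
    (LinearMap.mkContinuous_norm_le _ (norm_nonneg x) _) (f.toPreGNS a)

theorem norm_toPreGNS_one_mul_le (f : A →ₚ[ℂ] ℂ) (x : A) :
    ‖f.toPreGNS x‖ ≤ ‖x‖ * ‖f.toPreGNS 1‖ := by
  simpa using f.norm_toPreGNS_mul_le x 1

theorem apply_star (f : A →ₚ[ℂ] ℂ) (a : A) : f (star a) = star (f a) := map_star f a

theorem continuous_toPreGNS (f : A →ₚ[ℂ] ℂ) : Continuous fun a => f.toPreGNS a :=
  (LinearMap.mkContinuous f.toPreGNS.toLinearMap ‖f.toPreGNS 1‖ fun x => by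
    rw [mul_comm]; exact f.norm_toPreGNS_one_mul_le x).continuous

/-- A functional on `A` that is bounded for the seminorm of a positive functional `f` is
represented, on any finite set, by an element of `A`. -/
theorem exists_apply_star_mul_eq (f : A →ₚ[ℂ] ℂ) (g : A →ₗ[ℂ] ℂ) {K : ℝ} (hK : 0 ≤ K)
    (hg : ∀ a, ‖g a‖ ≤ K * ‖f.toPreGNS a‖) (F : Finset A) :
    ∃ c : A, ‖f.toPreGNS c‖ ≤ K ∧ ∀ a ∈ F, f (star c * a) = g a := by
  let e : f.PreGNS →ₗ[ℂ] f.GNS :=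
    (UniformSpace.Completion.toComplL (𝕜 := ℂ) (E := f.PreGNS)).toLinearMap
  let g' : f.PreGNS →ₗ[ℂ] ℂ := g ∘ₗ f.ofPreGNS.toLinearMap
  have he : DenseRange e := UniformSpace.Completion.denseRange_coe
  have hb : ∀ x, ‖g' x‖ ≤ K * ‖e x‖ := fun x => by
    have : ‖e x‖ = ‖x‖ := UniformSpace.Completion.norm_coe x
    rw [this]; exact hg (f.ofPreGNS x)
  let G := g'.extendOfNorm e
  let k : f.GNS := (InnerProductSpace.toDual ℂ f.GNS).symm G
  have hk : ‖k‖ ≤ K := by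
    rw [LinearIsometryEquiv.norm_map]
    exact LinearMap.opNorm_extendOfNorm_le he hK hb
  have hkin : ∀ a : f.PreGNS, ⟪k, e a⟫_ℂ = g' a := fun a => by
    rw [InnerProductSpace.toDual_symm_apply]
    exact LinearMap.extendOfNorm_eq he ⟨K, hb⟩ a
  classical
  let V : Submodule ℂ f.GNS :=
    Submodule.map e (Submodule.span ℂ ((F.image f.toPreGNS : Finset f.PreGNS) : Set f.PreGNS))
  have : FiniteDimensional ℂ (Submodule.span ℂ
      ((F.image f.toPreGNS : Finset f.PreGNS) : Set f.PreGNS)) :=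
    FiniteDimensional.span_finset _ _
  have : FiniteDimensional ℂ V := inferInstance
  have hp : V.starProjection k ∈ V := Submodule.starProjection_apply_mem _ _
  obtain ⟨c, -, hc⟩ := Submodule.mem_map.1 hp
  refine ⟨f.ofPreGNS c, ?_, fun a ha => ?_⟩
  · have h1 : ‖e c‖ = ‖c‖ := UniformSpace.Completion.norm_coe c
    change ‖c‖ ≤ K
    rw [← h1, hc]
    exact (V.norm_starProjection_apply_le k).trans hk
  · have haV : e (f.toPreGNS a) ∈ V :=
      Submodule.mem_map_of_mem
        (Submodule.subset_span (Finset.mem_coe.2 (Finset.mem_image_of_mem _ ha)))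
    have h1 : ⟪e c, e (f.toPreGNS a)⟫_ℂ = ⟪c, f.toPreGNS a⟫_ℂ :=
      UniformSpace.Completion.inner_coe _ _
    have h2 : ⟪e c, e (f.toPreGNS a)⟫_ℂ = ⟪k, e (f.toPreGNS a)⟫_ℂ := by
      rw [hc, Submodule.inner_starProjection_left_eq_right,
        Submodule.starProjection_eq_self_iff.2 haV]
    have h3 := h1.symm.trans (h2.trans (hkin _))
    exact h3

end PositiveLinearMap

theorem IsSelfAdjoint.exists_conjugate_eq_neg {y : C} (hy : IsSelfAdjoint y) :
    ∃ r s : C, star r = r ∧ r * y * r = -(star s * s) ∧ (s = 0 → ∃ t, y = star t * t) := by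
  have hn : star (y⁻) = y⁻ := (CFC.negPart_nonneg y).isSelfAdjoint
  have h0 : 0 ≤ y⁻ * y⁻ * y⁻ := by
    simpa using conjugate_nonneg_of_nonneg (CFC.negPart_nonneg y) (CFC.negPart_nonneg y)
  obtain ⟨s, hs⟩ := CStarAlgebra.nonneg_iff_eq_star_mul_self.1 h0
  refine ⟨y⁻, s, hn, ?_, fun h => ?_⟩
  · have h1 : y⁻ * y = -(y⁻ * y⁻) := by
      nth_rw 2 [← CFC.posPart_sub_negPart y hy]
      rw [mul_sub, CFC.negPart_mul_posPart, zero_sub]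
    rw [h1, neg_mul, hs]
  · have h3 : y⁻ * y⁻ * y⁻ = 0 := by rw [hs, h]; simp
    have h4 : star (y⁻ * y⁻) * (y⁻ * y⁻) = 0 := by
      rw [star_mul, hn, ← mul_assoc, h3, zero_mul]
    have h5 : star (y⁻) * y⁻ = 0 := by rw [hn, CStarRing.star_mul_self_eq_zero_iff _ |>.1 h4]
    refine CStarAlgebra.nonneg_iff_eq_star_mul_self.1 ?_
    rw [← CFC.posPart_sub_negPart y hy, CStarRing.star_mul_self_eq_zero_iff _ |>.1 h5, sub_zero]
    exact CFC.posPart_nonneg y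

theorem IsSelfAdjoint.nonneg_of_faithfulGNS {E : C →ₚ[ℂ] ℂ} (hE : FaithfulGNS E.toLinearMap)
    {y : C} (hy : IsSelfAdjoint y) (h : ∀ d, 0 ≤ E (star d * y * d)) : 0 ≤ y := by
  obtain ⟨r, s, hr, hs, hs0⟩ := hy.exists_conjugate_eq_neg
  refine CStarAlgebra.nonneg_iff_eq_star_mul_self.2 (hs0 (hE s fun x => ?_))
  have h1 := h (r * x)
  have h2 : star (r * x) * y * (r * x) = -(star (s * x) * (s * x)) := by
    calc star (r * x) * y * (r * x) = star x * (r * y * r) * x := by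
          rw [star_mul, hr]; simp only [mul_assoc]
      _ = -(star (s * x) * (s * x)) := by
          rw [hs]; simp only [star_mul, mul_assoc, mul_neg, neg_mul]
  rw [h2, map_neg] at h1
  exact le_antisymm (neg_nonneg.1 h1) (E.map_nonneg (star_mul_self_nonneg _))

theorem norm_le_of_faithfulGNS {E : C →ₚ[ℂ] ℂ} (hE : FaithfulGNS E.toLinearMap)
    {y : C} {K : ℝ} (hK : 0 ≤ K) (h : ∀ d, ‖E.toPreGNS (y * d)‖ ≤ K * ‖E.toPreGNS d‖) :
    ‖y‖ ≤ K := by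
  have hsa : IsSelfAdjoint (algebraMap ℝ C (K ^ 2) - star y * y) :=
    (IsSelfAdjoint.algebraMap C (IsSelfAdjoint.all (K ^ 2))).sub (IsSelfAdjoint.star_mul_self y)
  have hpos := hsa.nonneg_of_faithfulGNS hE fun d => by
    have h1 : star d * (algebraMap ℝ C (K ^ 2) - star y * y) * d
        = ((K ^ 2 : ℝ) : ℂ) • (star d * d) - star (y * d) * (y * d) := by
      rw [mul_sub, sub_mul, Algebra.algebraMap_eq_smul_one, Complex.coe_smul]
      simp [mul_assoc]
    rw [h1, map_sub, map_smul, E.apply_star_mul_self, E.apply_star_mul_self, smul_eq_mul,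
      ← Complex.ofReal_mul, ← Complex.ofReal_sub, Complex.zero_le_real, sub_nonneg, ← mul_pow]
    exact pow_le_pow_left₀ (norm_nonneg _) (h d) 2
  have h2 : ‖star y * y‖ ≤ K ^ 2 := by
    have := (CStarAlgebra.norm_le_iff_le_algebraMap (star y * y) (sq_nonneg K)
      (star_mul_self_nonneg y)).2 (sub_nonneg.1 hpos)
    exact this
  rw [CStarRing.norm_star_mul_self, ← sq] at h2
  exact le_of_sq_le_sq h2 hK

end CStar

section Kernel

/-- A kernel with values in a C⋆-algebra is positive if all the matrices it gives rise to are
positive. -/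
def IsPosKernel {X C : Type*} [CStarAlgebra C] [PartialOrder C] (K : X → X → C) : Prop :=
  ∀ (n : ℕ) (x : Fin n → X) (c : Fin n → C),
    0 ≤ ∑ i, ∑ j, star (c i) * K (x i) (x j) * c j

variable {X Y A C D : Type*} [CStarAlgebra A] [PartialOrder A] [StarOrderedRing A]
  [CStarAlgebra C] [PartialOrder C]
  [CStarAlgebra D] [PartialOrder D] [StarOrderedRing D]

namespace IsPosKernel

theorem comap {K : X → X → C} (hK : IsPosKernel K) (f : Y → X) :
    IsPosKernel fun x y => K (f x) (f y) :=
  fun n x c => hK n (fun i => f (x i)) c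

theorem sum_nonneg {K : X → X → C} (hK : IsPosKernel K) {κ : Type*} [Fintype κ]
    (x : κ → X) (c : κ → C) : 0 ≤ ∑ i, ∑ j, star (c i) * K (x i) (x j) * c j := by
  have h := hK (Fintype.card κ) (x ∘ (Fintype.equivFin κ).symm) (c ∘ (Fintype.equivFin κ).symm)
  rw [← Equiv.sum_comp (Fintype.equivFin κ)] at h
  refine h.trans_eq (Finset.sum_congr rfl fun i _ => ?_)
  rw [← Equiv.sum_comp (Fintype.equivFin κ)]
  simp

theorem add [StarOrderedRing C] {K L : X → X → C} (hK : IsPosKernel K) (hL : IsPosKernel L) :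
    IsPosKernel fun x y => K x y + L x y := fun n x c => by
  simpa [mul_add, add_mul, Finset.sum_add_distrib] using add_nonneg (hK n x c) (hL n x c)

theorem sandwich {K : X → X → C} (hK : IsPosKernel K) (f : X → C) :
    IsPosKernel fun x y => star (f x) * K x y * f y := fun n x c => by
  simpa [mul_assoc] using hK n x fun i => f (x i) * c i

theorem self_nonneg {K : X → X → C} (hK : IsPosKernel K) (x : X) : 0 ≤ K x x := by
  simpa using hK 1 (fun _ => x) fun _ => 1

open scoped MatrixOrder in
/-- Schur product of a positive scalar kernel and a positive kernel. -/
theorem smul [StarOrderedRing C] {K : X → X → C} (hK : IsPosKernel K) (f : A →ₚ[ℂ] ℂ) (h : X → A) :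
    IsPosKernel fun x y => f (star (h x) * h y) • K x y := fun n x c => by
  let M : Matrix (Fin n) (Fin n) ℂ := .of fun i j => f (star (h (x i)) * h (x j))
  have hM : M.PosSemidef := by
    refine .of_dotProduct_mulVec_nonneg ?_ fun v => ?_
    · ext i j
      simp [M, ← f.apply_star, Matrix.conjTranspose_apply]
    · have h1 : star v ⬝ᵥ M.mulVec v
          = f (star (∑ i, v i • h (x i)) * ∑ i, v i • h (x i)) := by
        simp only [dotProduct, Matrix.mulVec, Finset.mul_sum, star_sum, Finset.sum_mul, map_sum,
          star_smul, M, Matrix.of_apply, Pi.star_apply]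
        rw [Finset.sum_comm]
        refine Finset.sum_congr rfl fun i _ => Finset.sum_congr rfl fun j _ => ?_
        simp only [smul_mul_assoc, mul_smul_comm, map_smul, smul_eq_mul]
        ring
      rw [h1]
      exact f.map_nonneg (star_mul_self_nonneg _)
  obtain ⟨B : Matrix (Fin n) (Fin n) ℂ, hB⟩ := CStarAlgebra.nonneg_iff_eq_star_mul_self.1 hM.nonneg
  have hMij : ∀ i j, f (star (h (x i)) * h (x j)) = ∑ m, star (B m i) * B m j := fun i j => by
    have := congrFun (congrFun hB i) j
    simpa [M, Matrix.mul_apply, Matrix.star_apply] using this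
  have h2 : ∑ i, ∑ j, star (c i) * f (star (h (x i)) * h (x j)) • K (x i) (x j) * c j
      = ∑ m, ∑ i, ∑ j, star (B m i • c i) * K (x i) (x j) * (B m j • c j) := by
    symm
    rw [Finset.sum_comm]
    refine Finset.sum_congr rfl fun i _ => ?_
    rw [Finset.sum_comm]
    refine Finset.sum_congr rfl fun j _ => ?_
    rw [hMij, Finset.sum_smul, Finset.mul_sum, Finset.sum_mul]
    refine Finset.sum_congr rfl fun m _ => ?_
    simp only [star_smul, smul_mul_assoc, mul_smul_comm, smul_smul]
    rw [mul_comm]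
  rw [h2]
  exact Finset.sum_nonneg fun m _ => hK n x fun i => B m i • c i

end IsPosKernel

theorem exists_eq_sum_star_mul {n : ℕ} (M : Fin n → Fin n → D)
    (hsa : ∀ i j, star (M i j) = M j i)
    (hM : ∀ c : Fin n → D, 0 ≤ ∑ i, ∑ j, star (c i) * M i j * c j) :
    ∃ N : Fin n → Fin n → D, ∀ i j, M i j = ∑ k, star (N k i) * N k j := by
  let T : CStarMatrix (Fin n) (Fin n) D := CStarMatrix.ofMatrix (.of M)
  have hT : IsSelfAdjoint T := by
    ext i j
    exact hsa j i
  have hentry : ∀ (S : CStarMatrix (Fin n) (Fin n) D) i j,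
      (star S * S) i j = ∑ k, star (S k i) * S k j := fun S i j => by
    rw [CStarMatrix.mul_apply]; rfl
  obtain ⟨r, s, hr, hs, hs0⟩ := hT.exists_conjugate_eq_neg
  obtain ⟨N, hN⟩ := hs0 <| by
    ext m k
    have h1 := hM fun i => r i k
    have h2 : ∑ i, ∑ j, star (r i k) * M i j * r j k = (r * T * r) k k := by
      have h : r * T * r = star r * T * r := by rw [hr]
      rw [h, CStarMatrix.mul_apply, Finset.sum_comm]
      refine Finset.sum_congr rfl fun j _ => ?_
      rw [CStarMatrix.mul_apply, Finset.sum_mul]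
      rfl
    have h3 : (r * T * r) k k = -∑ m, star (s m k) * s m k := by
      rw [hs, ← hentry]; rfl
    rw [h2, h3] at h1
    have h4 : ∑ m, star (s m k) * s m k = 0 :=
      le_antisymm (neg_nonneg.1 h1) (Finset.sum_nonneg fun _ _ => star_mul_self_nonneg _)
    have h5 := (Finset.sum_eq_zero_iff_of_nonneg fun _ _ => star_mul_self_nonneg _).1 h4 m
      (Finset.mem_univ m)
    exact CStarRing.star_mul_self_eq_zero_iff _ |>.1 h5
  refine ⟨fun k i => N k i, fun i j => ?_⟩
  rw [← hentry, ← hN]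
  rfl

theorem IsPosKernel.map [StarOrderedRing C] {K : X → X → D} (hK : IsPosKernel K)
    (hsa : ∀ x y, star (K x y) = K y x) (e : D →⋆ₐ[ℂ] C) :
    IsPosKernel fun x y => e (K x y) := fun n x c => by
  obtain ⟨N, hN⟩ := exists_eq_sum_star_mul (fun i j => K (x i) (x j)) (fun _ _ => hsa _ _) (hK n x)
  have : ∑ i, ∑ j, star (c i) * e (K (x i) (x j)) * c j
      = ∑ k, star (∑ i, e (N k i) * c i) * ∑ i, e (N k i) * c i := by
    simp only [hN, map_sum, map_mul, map_star, Finset.mul_sum, Finset.sum_mul, star_sum, star_mul,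
      mul_assoc]
    rw [Finset.sum_comm]
    symm
    rw [Finset.sum_comm]
    exact Finset.sum_congr rfl fun i _ => Finset.sum_comm
  rw [this]
  exact Finset.sum_nonneg fun k _ => star_mul_self_nonneg _

/-- The Schwarz inequality for unital completely positive maps. -/
theorem IsCompletelyPositive.isPosKernel_sub {A : Type*} [CStarAlgebra A]
    {θ : A →ₗ[ℂ] D} (hθ : IsCompletelyPositive θ)
    (h1 : θ 1 = 1) (hs : ∀ a, θ (star a) = star (θ a)) :
    IsPosKernel fun a b => θ (star a * b) - star (θ a) * θ b := fun n x c => by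
  obtain ⟨d, hd⟩ := hθ (n + 1) (Fin.cons 1 x) (Fin.cons (-∑ i, θ (x i) * c i) c)
  have h2 : ∑ i, ∑ j, star (c i) * (θ (star (x i) * x j) - star (θ (x i)) * θ (x j)) * c j
      = star d * d := by
    rw [← hd]
    simp only [Fin.sum_univ_succ, Fin.cons_zero, Fin.cons_succ, star_one, one_mul, mul_one, h1, hs,
      mul_sub, sub_mul, Finset.sum_sub_distrib, star_neg, star_sum, star_mul,
      Finset.sum_add_distrib]
    have h3 : ∑ i, ∑ j, star (c i) * (star (θ (x i)) * θ (x j)) * c j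
        = (∑ i, star (c i) * star (θ (x i))) * ∑ j, θ (x j) * c j := by
      simp only [Finset.sum_mul, Finset.mul_sum, mul_assoc]
      exact Finset.sum_comm
    rw [h3, ← Finset.sum_mul]
    simp only [mul_assoc, ← Finset.mul_sum]
    simp only [neg_mul, mul_neg]
    abel
  rw [h2]
  exact star_mul_self_nonneg d

/-- A completely positive map as a positive linear map. -/
def IsCompletelyPositive.toPositiveLinearMap {θ : A →ₗ[ℂ] D} (hθ : IsCompletelyPositive θ) :
    A →ₚ[ℂ] D :=
  PositiveLinearMap.mk₀ θ fun x hx => by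
    obtain ⟨s, rfl⟩ := CStarAlgebra.nonneg_iff_eq_star_mul_self.1 hx
    obtain ⟨d, hd⟩ := hθ 1 (fun _ => s) fun _ => 1
    have : θ (star s * s) = star d * d := by simpa using hd
    rw [this]
    exact star_mul_self_nonneg d

theorem IsCompletelyPositive.map_star {θ : A →ₗ[ℂ] D} (hθ : IsCompletelyPositive θ) (a : A) :
    θ (star a) = star (θ a) :=
  StarHomClass.map_star hθ.toPositiveLinearMap a

end Kernel

section Words

variable {I : Type*} {A D : I → Type*} {C : Type*} [CStarAlgebra C]

/-- The product in `C` of the images of the letters of a word. -/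
def wordProd (f : ∀ i, A i → C) (l : List (Σ i, A i)) : C := (l.map fun p => f p.1 p.2).prod

/-- The adjoint of a word. -/
def starWord [∀ i, Star (A i)] (l : List (Σ i, A i)) : List (Σ i, A i) :=
  (l.map fun p => ⟨p.1, star p.2⟩).reverse

/-- Apply the maps `θ i` letter by letter. -/
def mapWord (θ : ∀ i, A i → D i) (l : List (Σ i, A i)) : List (Σ i, D i) :=
  l.map fun p => ⟨p.1, θ p.1 p.2⟩

@[simp] theorem wordProd_nil (f : ∀ i, A i → C) : wordProd f [] = 1 := rfl

@[simp] theorem wordProd_cons (f : ∀ i, A i → C) (p : Σ i, A i) (l : List (Σ i, A i)) :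
    wordProd f (p :: l) = f p.1 p.2 * wordProd f l := by
  simp [wordProd]

@[simp] theorem wordProd_append (f : ∀ i, A i → C) (l l' : List (Σ i, A i)) :
    wordProd f (l ++ l') = wordProd f l * wordProd f l' := by
  simp [wordProd]

@[simp] theorem wordProd_mapWord (f : ∀ i, D i → C) (θ : ∀ i, A i → D i) (l : List (Σ i, A i)) :
    wordProd f (mapWord θ l) = wordProd (fun i a => f i (θ i a)) l := by
  simp [wordProd, mapWord, Function.comp_def]

@[simp] theorem starWord_cons [∀ i, Star (A i)] (p : Σ i, A i) (l : List (Σ i, A i)) :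
    starWord (p :: l) = starWord l ++ [⟨p.1, star p.2⟩] := by
  simp [starWord]

theorem wordProd_starWord [∀ i, Star (A i)] {f : ∀ i, A i → C}
    (hf : ∀ i a, f i (star a) = star (f i a)) (l : List (Σ i, A i)) :
    wordProd f (starWord l) = star (wordProd f l) := by
  induction l with
  | nil => simp [starWord]
  | cons p l ih => simp [ih, hf]

theorem head?_starWord_avoids [∀ i, Star (A i)] {i : I} {l : List (Σ i, A i)}
    (h : ∀ q ∈ l.getLast?, i ≠ q.1) : ∀ q ∈ (starWord l).head?, i ≠ q.1 := by
  simp only [starWord, List.head?_reverse, List.getLast?_map, Option.mem_def,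
    Option.map_eq_some_iff]
  rintro _ ⟨q, hq, rfl⟩
  exact h q hq

theorem getLast?_starWord_avoids [∀ i, Star (A i)] {i : I} {l : List (Σ i, A i)}
    (h : ∀ q ∈ l.head?, i ≠ q.1) : ∀ q ∈ (starWord l).getLast?, i ≠ q.1 := by
  simp only [starWord, List.getLast?_reverse, List.head?_map, Option.mem_def,
    Option.map_eq_some_iff]
  rintro _ ⟨q, hq, rfl⟩
  exact h q hq

theorem wordProd_starWord_emb [∀ i, CStarAlgebra (A i)] (emb : ∀ i, A i →⋆ₐ[ℂ] C)
    (l : List (Σ i, A i)) :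
    wordProd (fun i => emb i) (starWord l) = star (wordProd (fun i => emb i) l) :=
  wordProd_starWord (fun i a => map_star (emb i) a) l

variable [∀ i, CStarAlgebra (A i)] [∀ i, PartialOrder (A i)]
  [∀ i, CStarAlgebra (D i)] [∀ i, PartialOrder (D i)]

/-- A word is reduced if neighbouring letters come from different algebras and all letters are
centered. -/
def IsReducedWord (φ : ∀ i, A i →ₚ[ℂ] ℂ) (l : List (Σ i, A i)) : Prop :=
  l.IsChain (fun p q => p.1 ≠ q.1) ∧ ∀ p ∈ l, φ p.1 p.2 = 0

namespace IsReducedWord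

variable {φ : ∀ i, A i →ₚ[ℂ] ℂ} {ψ : ∀ i, D i →ₚ[ℂ] ℂ}

theorem nil : IsReducedWord φ [] := ⟨.nil, by simp⟩

theorem cons_iff {p : Σ i, A i} {l : List (Σ i, A i)} :
    IsReducedWord φ (p :: l) ↔ φ p.1 p.2 = 0 ∧ (∀ q ∈ l.head?, p.1 ≠ q.1) ∧ IsReducedWord φ l := by
  simp only [IsReducedWord, List.isChain_cons, List.forall_mem_cons]
  tauto

theorem append_iff {l l' : List (Σ i, A i)} :
    IsReducedWord φ (l ++ l') ↔ IsReducedWord φ l ∧ IsReducedWord φ l' ∧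
      ∀ p ∈ l.getLast?, ∀ q ∈ l'.head?, p.1 ≠ q.1 := by
  simp only [IsReducedWord, List.isChain_append, List.forall_mem_append]
  tauto

theorem starWord [∀ i, StarOrderedRing (A i)] {l : List (Σ i, A i)} (hl : IsReducedWord φ l) :
    IsReducedWord φ (starWord l) := by
  refine ⟨?_, fun p hp => ?_⟩
  · rw [_root_.starWord, List.isChain_reverse, List.isChain_map]
    exact hl.1.imp fun p q h => h.symm
  · simp only [_root_.starWord, List.mem_reverse, List.mem_map] at hp
    obtain ⟨q, hq, rfl⟩ := hp
    simp [(φ q.1).apply_star, hl.2 q hq]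

theorem mapWord {l : List (Σ i, A i)} (hl : IsReducedWord φ l) {θ : ∀ i, A i → D i}
    (hθ : ∀ i a, ψ i (θ i a) = φ i a) : IsReducedWord ψ (mapWord θ l) := by
  refine ⟨?_, fun p hp => ?_⟩
  · rw [_root_.mapWord, List.isChain_map]
    exact hl.1
  · simp only [_root_.mapWord, List.mem_map] at hp
    obtain ⟨q, hq, rfl⟩ := hp
    rw [hθ, hl.2 q hq]

end IsReducedWord

/-- The family of embeddings `emb i : A i → C` is free with respect to the state `E`, which
restricts to `φ i` on `A i`. -/
structure IsFreeFamily [PartialOrder C] [StarOrderedRing C] (φ : ∀ i, A i →ₚ[ℂ] ℂ)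
    (emb : ∀ i, A i →⋆ₐ[ℂ] C) (E : C →ₚ[ℂ] ℂ) : Prop where
  map_one : E 1 = 1
  restrict : ∀ i a, E (emb i a) = φ i a
  free : ∀ l, IsReducedWord φ l → l ≠ [] → E (wordProd (fun i => emb i) l) = 0
  faithful : FaithfulGNS E.toLinearMap
  generating :
    Dense ((StarAlgebra.adjoin ℂ (⋃ i, Set.range (emb i)) : StarSubalgebra ℂ C) : Set C)

namespace IsFreeFamily

variable [PartialOrder C] [StarOrderedRing C] {φ : ∀ i, A i →ₚ[ℂ] ℂ}
    {emb : ∀ i, A i →⋆ₐ[ℂ] C} {E : C →ₚ[ℂ] ℂ}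

theorem apply_one (h : IsFreeFamily φ emb E) (i : I) : φ i 1 = 1 := by
  rw [← h.restrict, _root_.map_one, h.map_one]

theorem apply_center (h : IsFreeFamily φ emb E) (i : I) (a : A i) :
    φ i (a - φ i a • 1) = 0 := by
  rw [map_sub, map_smul, h.apply_one, smul_eq_mul, mul_one, sub_self]

theorem exists_center (h : IsFreeFamily φ emb E) (i : I) (a : A i) :
    ∃ z : A i, φ i z = 0 ∧ a = z + φ i a • 1 :=
  ⟨a - φ i a • 1, h.apply_center i a, by simp⟩

variable [∀ i, StarOrderedRing (A i)]

theorem apply_eq_zero_of_length_lt (h : IsFreeFamily φ emb E) {w b d : List (Σ i, A i)}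
    (hw : IsReducedWord φ w) (hb : IsReducedWord φ b) (hd : IsReducedWord φ d)
    (hlen : d.length < w.length)
    (hwb : ∀ p ∈ w.head?, ∀ q ∈ b.head?, p.1 ≠ q.1) :
    E (star (wordProd (fun i => emb i) w) * wordProd (fun i => emb i) b *
      wordProd (fun i => emb i) d) = 0 := by
  induction d generalizing w b with
  | nil =>
    rw [← wordProd_starWord_emb, ← wordProd_append, ← wordProd_append, List.append_nil]
    cases w with
    | nil => simp at hlen
    | cons p w =>
      refine h.free _ (IsReducedWord.append_iff.2 ⟨hw.starWord, hb, ?_⟩) (by simp)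
      simpa [starWord] using hwb
  | cons k d ih =>
    rw [IsReducedWord.cons_iff] at hd
    have hlen' : d.length < w.length := by rw [List.length_cons] at hlen; omega
    rcases List.eq_nil_or_concat b with rfl | ⟨b, j, rfl⟩
    · cases w with
      | nil => simp at hlen
      | cons p w =>
        obtain ⟨i, α⟩ := p
        obtain ⟨k, δ⟩ := k
        by_cases hik : i = k
        · subst hik
          have hw' := IsReducedWord.cons_iff.1 hw
          obtain ⟨z, hz, hz'⟩ := h.exists_center i (star α * δ)
          have hlen'' : d.length < w.length := by simpa using hlen
          have h1 := ih (b := [⟨i, z⟩]) hw'.2.2 (IsReducedWord.cons_iff.2 ⟨hz, by simp, .nil⟩)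
            hd.2.2 hlen'' (fun p hp q hq => by
              have := hw'.2.1 p hp
              simp only [List.head?_cons, Option.mem_some_iff] at hq
              subst hq
              exact this.symm)
          have h2 := ih (b := []) hw'.2.2 .nil hd.2.2 hlen'' (by simp)
          have h3 : star (emb i α) * emb i δ = emb i z + φ i (star α * δ) • 1 := by
            rw [← map_star, ← map_mul, hz', map_add, map_smul, _root_.map_one]
            simp [hz, h.apply_one]
          calc _ = E (star (wordProd (fun i => emb i) w) * (star (emb i α) * emb i δ) *
                wordProd (fun i => emb i) d) := by simp [mul_assoc]
            _ = 0 := by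
              rw [h3, mul_add, add_mul, map_add]
              simp only [wordProd_cons, wordProd_nil, mul_one] at h1 h2
              simp [h1, h2]
        · have h1 := ih (b := [⟨k, δ⟩]) hw (IsReducedWord.cons_iff.2 ⟨hd.1, by simp, .nil⟩) hd.2.2
            hlen' (by simpa using hik)
          simpa [mul_assoc] using h1
    · rw [List.concat_eq_append] at hb hwb ⊢
      obtain ⟨j, β⟩ := j
      obtain ⟨k, δ⟩ := k
      have hb' := IsReducedWord.append_iff.1 hb
      by_cases hjk : j = k
      · subst hjk
        obtain ⟨z, hz, hz'⟩ := h.exists_center j (β * δ)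
        have h1 := ih (b := b ++ [⟨j, z⟩]) hw (IsReducedWord.append_iff.2 ⟨hb'.1,
          IsReducedWord.cons_iff.2 ⟨hz, by simp, .nil⟩, by simpa using hb'.2.2⟩) hd.2.2 hlen' (by
            intro p hp q hq
            cases b with
            | nil =>
              simp only [List.nil_append, List.head?_cons, Option.mem_some_iff] at hq
              subst hq
              exact hwb p hp ⟨j, β⟩ (by simp)
            | cons r b => exact hwb p hp q (by simpa using hq))
        have h2 := ih (b := b) hw hb'.1 hd.2.2 hlen' (by
          intro p hp q hq
          cases b with
          | nil => simp at hq
          | cons r b => exact hwb p hp q (by simpa using hq))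
        have h3 : emb j β * emb j δ = emb j z + φ j (β * δ) • 1 := by
          rw [← map_mul, hz', map_add, map_smul, _root_.map_one]
          simp [hz, h.apply_one]
        calc _ = E (star (wordProd (fun i => emb i) w) * wordProd (fun i => emb i) b *
              (emb j β * emb j δ) * wordProd (fun i => emb i) d) := by simp [mul_assoc]
          _ = 0 := by
            rw [h3, mul_add, add_mul, map_add]
            simp only [wordProd_append, wordProd_cons, wordProd_nil, mul_one] at h1 h2
            simp only [← mul_assoc] at h1
            simp [h1, h2]
      · have h1 := ih (b := b ++ [⟨j, β⟩] ++ [⟨k, δ⟩]) hw (IsReducedWord.append_iff.2 ⟨hb,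
          IsReducedWord.cons_iff.2 ⟨hd.1, by simp, .nil⟩, by simpa using hjk⟩) hd.2.2
            hlen' (by
              intro p hp q hq
              refine hwb p hp q ?_
              cases b <;> simpa using hq)
        simpa [mul_assoc] using h1

theorem apply_conj_emb (h : IsFreeFamily φ emb E) {i : I} {d : List (Σ i, A i)}
    (hd : IsReducedWord φ d) (hi : ∀ p ∈ d.head?, i ≠ p.1) (y : A i) :
    E (star (wordProd (fun i => emb i) d) * emb i y * wordProd (fun i => emb i) d) =
      φ i y * E (star (wordProd (fun i => emb i) d) * wordProd (fun i => emb i) d) := by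
  obtain ⟨z, hz, hz'⟩ := h.exists_center i y
  have h1 := h.apply_eq_zero_of_length_lt (w := ⟨i, star z⟩ :: d) (b := []) (d := d)
    (IsReducedWord.cons_iff.2 ⟨by simp [(φ i).apply_star, hz], hi, hd⟩) .nil hd (by simp) (by simp)
  have h2 : emb i y = emb i z + φ i y • 1 := by
    conv_lhs => rw [hz']
    rw [map_add, map_smul, _root_.map_one]
  simp only [wordProd_cons, star_mul, ← map_star, star_star, wordProd_nil, mul_one] at h1
  rw [h2, mul_add, add_mul, map_add, h1]
  simp

theorem apply_conj_emb_mul_mul_emb (h : IsFreeFamily φ emb E) {i : I} {b d : List (Σ i, A i)}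
    (hd : IsReducedWord φ d) (hi : ∀ p ∈ d.head?, i ≠ p.1) (hb : IsReducedWord φ b)
    (hne : b ≠ []) (hbh : ∀ p ∈ b.head?, i ≠ p.1) (hbl : ∀ p ∈ b.getLast?, i ≠ p.1)
    (y y' : A i) :
    E (star (wordProd (fun i => emb i) d) *
        (emb i y * wordProd (fun i => emb i) b * emb i y') * wordProd (fun i => emb i) d) =
      φ i y * φ i y' * E (star (wordProd (fun i => emb i) d) * wordProd (fun i => emb i) b *
        wordProd (fun i => emb i) d) := by
  have key : ∀ (b : List (Σ i, A i)), IsReducedWord φ b → b ≠ [] → (∀ p ∈ b.head?, i ≠ p.1) →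
      (∀ p ∈ b.getLast?, i ≠ p.1) → ∀ z y' : A i, φ i z = 0 →
      E (star (wordProd (fun i => emb i) d) *
        (emb i z * wordProd (fun i => emb i) b * emb i y') * wordProd (fun i => emb i) d) = 0 := by
    intro b hb hne hbh hbl z y' hz
    have hw : IsReducedWord φ (⟨i, star z⟩ :: d) :=
      IsReducedWord.cons_iff.2 ⟨by simp [(φ i).apply_star, hz], hi, hd⟩
    obtain ⟨z', hz', hz''⟩ := h.exists_center i y'
    have h1 := h.apply_eq_zero_of_length_lt (b := b) hw hb hd (by simp) (by simpa using hbh)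
    have h2 := h.apply_eq_zero_of_length_lt (b := b ++ [⟨i, z'⟩]) hw
      (IsReducedWord.append_iff.2 ⟨hb, IsReducedWord.cons_iff.2 ⟨hz', by simp, .nil⟩, by
        simpa [eq_comm] using hbl⟩) hd (by simp) (by
          cases b with
          | nil => exact absurd rfl hne
          | cons r b => simpa using hbh)
    have h3 : emb i y' = emb i z' + φ i y' • 1 := by
      conv_lhs => rw [hz'']
      rw [map_add, map_smul, _root_.map_one]
    simp only [wordProd_append, wordProd_cons, star_mul, ← map_star, star_star, wordProd_nil,
      mul_one, ← mul_assoc] at h1 h2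
    rw [h3]
    simp only [mul_add, add_mul, map_add, ← mul_assoc]
    simp [h1, h2]
  obtain ⟨z, hz, hzy⟩ := h.exists_center i y
  obtain ⟨z', hz', hz''⟩ := h.exists_center i y'
  have h1 := key b hb hne hbh hbl z y' hz
  have h2 := key (starWord b) hb.starWord (by simpa [starWord] using hne)
    (head?_starWord_avoids hbl) (getLast?_starWord_avoids hbh)
    (star z') 1 (by simp [(φ i).apply_star, hz'])
  rw [← star_inj, ← E.apply_star] at h2
  simp only [wordProd_starWord_emb, _root_.map_one, mul_one, star_mul, star_star, map_star,
    star_zero, ← mul_assoc] at h2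
  have h3 : emb i y' = emb i z' + φ i y' • 1 := by
    conv_lhs => rw [hz'']
    rw [map_add, map_smul, _root_.map_one]
  have h4 : emb i y = emb i z + φ i y • 1 := by
    conv_lhs => rw [hzy]
    rw [map_add, map_smul, _root_.map_one]
  rw [h4]
  simp only [mul_add, add_mul, map_add, ← mul_assoc] at h1 ⊢
  rw [h1, zero_add, h3]
  simp only [mul_add, add_mul, map_add]
  simp only [mul_smul_comm, smul_mul_assoc, mul_one, map_smul, h2, smul_eq_mul]
  ring

/-- The linear span of the reduced words is dense. -/
theorem dense_span_wordProd (h : IsFreeFamily φ emb E) :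
    Dense (Submodule.span ℂ (Set.range fun l : {l // IsReducedWord φ l} =>
      wordProd (fun i => emb i) l.1) : Set C) := by
  set S := Submodule.span ℂ (Set.range fun l : {l // IsReducedWord φ l} =>
      wordProd (fun i => emb i) l.1)
  have hmem : ∀ l, IsReducedWord φ l → wordProd (fun i => emb i) l ∈ S := fun l hl =>
    Submodule.subset_span ⟨⟨l, hl⟩, rfl⟩
  have hemb : ∀ i (z : A i), φ i z = 0 → ∀ l, IsReducedWord φ l → (∀ q ∈ l.head?, i ≠ q.1) →
      emb i z * wordProd (fun i => emb i) l ∈ S := fun i z hz l hl hi => by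
    simpa using hmem (⟨i, z⟩ :: l) (IsReducedWord.cons_iff.2 ⟨hz, hi, hl⟩)
  have hemb' : ∀ i (a : A i) l, IsReducedWord φ l → (∀ q ∈ l.head?, i ≠ q.1) →
      emb i a * wordProd (fun i => emb i) l ∈ S := fun i a l hl hi => by
    obtain ⟨z, hz, hza⟩ := h.exists_center i a
    rw [hza, map_add, map_smul, _root_.map_one, add_mul, smul_mul_assoc, one_mul]
    exact S.add_mem (hemb i z hz l hl hi) (S.smul_mem _ (hmem l hl))
  have hmul : ∀ i (a : A i), ∀ y ∈ S, emb i a * y ∈ S := fun i a y hy => by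
    induction hy using Submodule.span_induction with
    | zero => simp
    | add y y' _ _ h1 h2 => rw [mul_add]; exact S.add_mem h1 h2
    | smul c y _ h1 => rw [mul_smul_comm]; exact S.smul_mem c h1
    | mem y hy =>
      obtain ⟨⟨l, hl⟩, rfl⟩ := hy
      rcases l with _ | ⟨⟨j, b⟩, l⟩
      · exact hemb' i a [] .nil (by simp)
      · by_cases hij : i = j
        · subst hij
          rw [IsReducedWord.cons_iff] at hl
          simpa [mul_assoc] using hemb' i (a * b) l hl.2.2 hl.2.1
        · exact hemb' i a _ hl (by simpa using hij)
  have hadj : ∀ x ∈ StarAlgebra.adjoin ℂ (⋃ i, Set.range (emb i)),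
      (∀ y ∈ S, x * y ∈ S) ∧ ∀ y ∈ S, star x * y ∈ S := fun x hx => by
    induction hx using StarAlgebra.adjoin_induction with
    | mem x hx =>
      obtain ⟨i, a, rfl⟩ := Set.mem_iUnion.1 hx
      exact ⟨hmul i a, by rw [← map_star]; exact hmul i (star a)⟩
    | algebraMap r =>
      simp only [Algebra.algebraMap_eq_smul_one, star_smul, star_one, smul_mul_assoc, one_mul]
      exact ⟨fun y hy => S.smul_mem _ hy, fun y hy => S.smul_mem _ hy⟩
    | add x x' _ _ h1 h2 =>
      simp only [star_add, add_mul]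
      exact ⟨fun y hy => S.add_mem (h1.1 y hy) (h2.1 y hy),
        fun y hy => S.add_mem (h1.2 y hy) (h2.2 y hy)⟩
    | mul x x' _ _ h1 h2 =>
      simp only [star_mul, mul_assoc]
      exact ⟨fun y hy => h1.1 _ (h2.1 y hy), fun y hy => h2.2 _ (h1.2 y hy)⟩
    | star x _ h1 => exact ⟨h1.2, by simpa using h1.1⟩
  refine h.generating.mono fun x hx => ?_
  simpa using (hadj x hx).1 1 (hmem [] .nil)

end IsFreeFamily

end Words

section KernelExtension

variable {X C : Type*} [CStarAlgebra C] [PartialOrder C] [StarOrderedRing C]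

theorem IsPosKernel.zero : IsPosKernel fun _ _ : X => (0 : C) := fun n x c => by simp

theorem IsPosKernel.finsetSum {κ : Type*} (T : Finset κ) {K : κ → X → X → C}
    (hK : ∀ i ∈ T, IsPosKernel (K i)) : IsPosKernel fun x y => ∑ i ∈ T, K i x y := by
  classical
  induction T using Finset.induction_on with
  | empty => simpa using IsPosKernel.zero
  | insert i T hi ih =>
    simp only [Finset.sum_insert hi]
    exact (hK i (by simp)).add (ih fun j hj => hK j (by simp [hj]))

/-- The sesquilinear extension of a kernel to formal linear combinations. -/
def kernelExtend (K : X → X → C) (f g : X →₀ ℂ) : C :=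
  f.sum fun u a => g.sum fun v b => (star a * b) • K u v

theorem IsPosKernel.kernelExtend {K : X → X → C} (hK : IsPosKernel K) :
    IsPosKernel (kernelExtend K) := fun n f c => by
  classical
  let s : Finset X := Finset.univ.biUnion fun k => (f k).support
  have hs : ∀ k, (f k).support ⊆ s := fun k =>
    Finset.subset_biUnion_of_mem (fun k => (f k).support) (Finset.mem_univ k)
  have h1 : ∀ k l, _root_.kernelExtend K (f k) (f l)
      = ∑ u : s, ∑ v : s, (star (f k u) * f l v) • K u v := fun k l => by
    rw [_root_.kernelExtend, Finsupp.sum_of_support_subset _ (hs k) _ (by simp),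
      ← Finset.sum_coe_sort s]
    refine Finset.sum_congr rfl fun u _ => ?_
    rw [Finsupp.sum_of_support_subset _ (hs l) _ (by simp), ← Finset.sum_coe_sort s]
  refine (hK.sum_nonneg (fun u : s => u.1) fun u => ∑ k, f k u • c k).trans_eq ?_
  simp only [h1, star_sum, star_smul, Finset.sum_mul, Finset.mul_sum, smul_mul_assoc,
    mul_smul_comm, smul_smul, Finset.smul_sum]
  have h2 : ∀ F : s → s → Fin n → Fin n → C,
      ∑ u, ∑ v, ∑ l, ∑ k, F u v k l = ∑ k, ∑ l, ∑ u, ∑ v, F u v k l := fun F => by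
    simp_rw [← Fintype.sum_prod_type']
    let e : (s × s × Fin n × Fin n) ≃ (Fin n × Fin n × s × s) :=
      ⟨fun p => (p.2.2.2, p.2.2.1, p.1, p.2.1), fun p => (p.2.2.1, p.2.2.2, p.2.1, p.1),
        fun _ => rfl, fun _ => rfl⟩
    exact e.sum_comp fun p => F p.2.2.1 p.2.2.2 p.1 p.2.1
  rw [h2 fun u v k l => (f l v * star (f k u)) • (star (c k) * K u v * c l)]
  simp only [mul_comm]

end KernelExtension

section Graph

variable {I : Type*} {A D : I → Type*}
  [∀ i, CStarAlgebra (A i)] [∀ i, PartialOrder (A i)]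
  [∀ i, CStarAlgebra (D i)] [∀ i, PartialOrder (D i)]
  {CA CD : Type*} [CStarAlgebra CA] [PartialOrder CA] [StarOrderedRing CA]
  [CStarAlgebra CD] [PartialOrder CD] [StarOrderedRing CD]

/-- The data of unital completely positive maps `θ i : A i → D i` compatible with states, together
with free families of embeddings of the algebras `A i` and `D i`. -/
structure IsFreeCPFamily (φ : ∀ i, A i →ₚ[ℂ] ℂ) (embA : ∀ i, A i →⋆ₐ[ℂ] CA) (EA : CA →ₚ[ℂ] ℂ)
    (ψ : ∀ i, D i →ₚ[ℂ] ℂ) (embD : ∀ i, D i →⋆ₐ[ℂ] CD) (ED : CD →ₚ[ℂ] ℂ)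
    (θ : ∀ i, A i →ₗ[ℂ] D i) : Prop where
  freeA : IsFreeFamily φ embA EA
  freeD : IsFreeFamily ψ embD ED
  faithfulA : ∀ i, FaithfulGNS (φ i).toLinearMap
  cp : ∀ i, IsCompletelyPositive (θ i)
  map_one : ∀ i, θ i 1 = 1
  compat : ∀ i a, ψ i (θ i a) = φ i a

/-- The graph of the free product map on the span of the reduced words. -/
def wordGraph (φ : ∀ i, A i →ₚ[ℂ] ℂ) (embA : ∀ i, A i →⋆ₐ[ℂ] CA) (embD : ∀ i, D i →⋆ₐ[ℂ] CD)
    (θ : ∀ i, A i →ₗ[ℂ] D i) : Submodule ℂ (CA × CD) :=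
  Submodule.span ℂ (Set.range fun l : {l // IsReducedWord φ l} =>
    (wordProd (fun i => embA i) l.1, wordProd (fun i a => embD i (θ i a)) l.1))

/-- The defect of multiplicativity of the maps `θ i` on the first letters of two words. -/
def headDefect [DecidableEq I] (embD : ∀ i, D i →⋆ₐ[ℂ] CD) (θ : ∀ i, A i →ₗ[ℂ] D i) :
    List (Σ i, A i) → List (Σ i, A i) → CD
  | p :: _, q :: _ => embD p.1 (θ p.1 (star p.2 * Pi.single q.1 q.2 p.1) -
      star (θ p.1 p.2) * θ p.1 (Pi.single q.1 q.2 p.1))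
  | _, _ => 0

/-- The defect of multiplicativity of the free product map on words. -/
def wordDefect [DecidableEq I] (embA : ∀ i, A i →⋆ₐ[ℂ] CA) (EA : CA →ₚ[ℂ] ℂ)
    (embD : ∀ i, D i →⋆ₐ[ℂ] CD) (θ : ∀ i, A i →ₗ[ℂ] D i) :
    List (Σ i, A i) → List (Σ i, A i) → CD
  | p :: u, q :: v => EA (star (embA p.1 p.2) * embA q.1 q.2) • wordDefect embA EA embD θ u v +
      star (wordProd (fun i a => embD i (θ i a)) u) * headDefect embD θ (p :: u) (q :: v) *
        wordProd (fun i a => embD i (θ i a)) v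
  | _, _ => 0

/-- The component in `A i` of the first letter of a word. -/
def headLetter [DecidableEq I] (i : I) : List (Σ i, A i) → A i
  | [] => 0
  | p :: _ => Pi.single p.1 p.2 i

variable {φ : ∀ i, A i →ₚ[ℂ] ℂ} {embA : ∀ i, A i →⋆ₐ[ℂ] CA} {EA : CA →ₚ[ℂ] ℂ}
  {ψ : ∀ i, D i →ₚ[ℂ] ℂ} {embD : ∀ i, D i →⋆ₐ[ℂ] CD} {ED : CD →ₚ[ℂ] ℂ}
  {θ : ∀ i, A i →ₗ[ℂ] D i}

theorem wordProd_mem_wordGraph {l : List (Σ i, A i)} (hl : IsReducedWord φ l) :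
    (wordProd (fun i => embA i) l, wordProd (fun i a => embD i (θ i a)) l) ∈
      wordGraph φ embA embD θ :=
  Submodule.subset_span ⟨⟨l, hl⟩, rfl⟩

namespace IsFreeCPFamily

variable [∀ i, StarOrderedRing (A i)] [∀ i, StarOrderedRing (D i)]

theorem map_star (h : IsFreeCPFamily φ embA EA ψ embD ED θ) (i : I) (a : A i) :
    θ i (star a) = star (θ i a) := (h.cp i).map_star a

theorem wordProd_starWord_comp (h : IsFreeCPFamily φ embA EA ψ embD ED θ)
    (l : List (Σ i, A i)) :
    wordProd (fun i a => embD i (θ i a)) (starWord l) =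
      star (wordProd (fun i a => embD i (θ i a)) l) :=
  wordProd_starWord (fun i a => by rw [h.map_star, StarHomClass.map_star]) l

theorem isPosKernel_headDefect [DecidableEq I] (h : IsFreeCPFamily φ embA EA ψ embD ED θ) :
    IsPosKernel (headDefect embD θ) := fun n x c => by
  let T : Finset I := Finset.univ.biUnion fun k => ((x k).head?.map Sigma.fst).toFinset
  have h1 : IsPosKernel fun l l' : List (Σ i, A i) => ∑ i ∈ T,
      embD i (θ i (star (headLetter i l) * headLetter i l') -
        star (θ i (headLetter i l)) * θ i (headLetter i l')) :=
    IsPosKernel.finsetSum T fun i _ =>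
      (((h.cp i).isPosKernel_sub (h.map_one i) (h.map_star i)).map
        (fun a b => by simp [← h.map_star]) (embD i)).comap (headLetter i)
  refine (h1 n x c).trans_eq (Finset.sum_congr rfl fun k _ => Finset.sum_congr rfl fun l _ => ?_)
  congr 2
  rcases hk : x k with _ | ⟨p, u⟩
  · simp [headDefect, headLetter]
  rcases hl : x l with _ | ⟨q, v⟩
  · simp [headDefect, headLetter]
  beta_reduce
  rw [Finset.sum_eq_single_of_mem p.1]
  · simp [headDefect, headLetter]
  · exact Finset.mem_biUnion.2 ⟨k, Finset.mem_univ k, by simp [hk]⟩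
  · intro i _ hi
    simp [headLetter, Pi.single_eq_of_ne hi]

theorem isPosKernel_wordDefect [DecidableEq I] (h : IsFreeCPFamily φ embA EA ψ embD ED θ) :
    IsPosKernel (wordDefect embA EA embD θ) := by
  have key : ∀ N : ℕ, IsPosKernel fun l l' : List (Σ i, A i) =>
      wordDefect embA EA embD θ (l.take N) (l'.take N) := fun N => by
    induction N with
    | zero => simpa [wordDefect] using IsPosKernel.zero
    | succ N ih =>
      let g : List (Σ i, A i) → CA
        | [] => 0
        | p :: _ => embA p.1 p.2
      have h1 := (ih.comap List.tail).smul EA g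
      have h2 := h.isPosKernel_headDefect.sandwich
        fun l => wordProd (fun i a => embD i (θ i a)) (l.tail.take N)
      convert h1.add h2 using 3 with l l'
      rcases l with _ | ⟨p, u⟩
      · simp [wordDefect, g, headDefect]
      rcases l' with _ | ⟨q, v⟩
      · simp [wordDefect, g, headDefect]
      simp [wordDefect, g, headDefect]
  intro n x c
  let N := Finset.univ.sup fun k => (x k).length
  have hN : ∀ k, (x k).take N = x k := fun k =>
    List.take_of_length_le (Finset.le_sup (f := fun k => (x k).length) (Finset.mem_univ k))
  simpa [hN] using key N n x c

theorem mul_mem_wordGraph [DecidableEq I] (h : IsFreeCPFamily φ embA EA ψ embD ED θ)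
    {l l' : List (Σ i, A i)} (hl : IsReducedWord φ l) (hl' : IsReducedWord φ l') :
    (star (wordProd (fun i => embA i) l) * wordProd (fun i => embA i) l',
      star (wordProd (fun i a => embD i (θ i a)) l) * wordProd (fun i a => embD i (θ i a)) l' +
        wordDefect embA EA embD θ l l') ∈ wordGraph φ embA embD θ := by
  have hW : ∀ {l l' : List (Σ i, A i)}, IsReducedWord φ (starWord l ++ l') →
      (star (wordProd (fun i => embA i) l) * wordProd (fun i => embA i) l',
      star (wordProd (fun i a => embD i (θ i a)) l) * wordProd (fun i a => embD i (θ i a)) l') ∈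
        wordGraph φ embA embD θ := fun {l l'} hll' => by
    have := wordProd_mem_wordGraph (embA := embA) (embD := embD) (θ := θ) hll'
    rwa [wordProd_append, wordProd_append, wordProd_starWord_emb, h.wordProd_starWord_comp]
      at this
  induction l generalizing l' with
  | nil => simpa [wordDefect] using wordProd_mem_wordGraph hl'
  | cons p u ih =>
    rcases l' with _ | ⟨q, v⟩
    · simpa [wordDefect] using
          hW (l := p :: u) (l' := []) (by rw [List.append_nil]; exact hl.starWord)
    · obtain ⟨i, a⟩ := p
      obtain ⟨j, b⟩ := q
      have hl1 := IsReducedWord.cons_iff.1 hl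
      have hl2 := IsReducedWord.cons_iff.1 hl'
      by_cases hij : i = j
      · subst hij
        obtain ⟨z, hz, hzab⟩ := h.freeA.exists_center i (star a * b)
        have hE : EA (star (embA i a) * embA i b) = φ i (star a * b) := by
          rw [← StarHomClass.map_star, ← map_mul, h.freeA.restrict]
        have h1 := ih hl1.2.2 hl2.2.2
        have h2 := hW (l := u) (l' := ⟨i, z⟩ :: v) (IsReducedWord.append_iff.2
          ⟨hl1.2.2.starWord, IsReducedWord.cons_iff.2 ⟨hz, hl2.2.1, hl2.2.2⟩, fun p hp q hq => by
            simp only [List.head?_cons, Option.mem_some_iff] at hq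
            subst hq
            exact (getLast?_starWord_avoids hl1.2.1 p hp).symm⟩)
        have h3 := Submodule.add_mem _ h2 (Submodule.smul_mem _ (φ i (star a * b)) h1)
        convert h3 using 1
        have hA : star (embA i a) * embA i b = embA i z + φ i (star a * b) • 1 := by
          rw [← StarHomClass.map_star, ← map_mul, hzab, map_add, map_smul, _root_.map_one]
          simp [hz, h.freeA.apply_one]
        have hD : embD i (θ i (star a * b)) = embD i (θ i z) + φ i (star a * b) • 1 := by
          conv_lhs => rw [hzab]
          rw [map_add, map_smul, h.map_one, map_add, map_smul, _root_.map_one]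
        refine Prod.ext ?_ ?_
        · calc _ = star (wordProd (fun i => embA i) u) * (star (embA i a) * embA i b) *
                wordProd (fun i => embA i) v := by simp [mul_assoc]
            _ = _ := by rw [hA]; simp [mul_add, add_mul, mul_assoc]
        · simp only [wordDefect, headDefect, hE, Pi.single_eq_same, map_sub, hD, map_mul,
            StarHomClass.map_star, wordProd_cons, star_mul, Prod.snd_add, Prod.smul_snd, smul_add]
          simp only [mul_sub, sub_mul, mul_add, add_mul, mul_smul_comm, smul_mul_assoc, mul_one,
            mul_assoc]
          abel
      · have h1 := hW (l := ⟨i, a⟩ :: u) (l' := ⟨j, b⟩ :: v) (IsReducedWord.append_iff.2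
          ⟨hl.starWord, hl', by simpa using hij⟩)
        have h2 : EA (star (embA i a) * embA j b) = 0 := by
          have := h.freeA.free [⟨i, star a⟩, ⟨j, b⟩] (IsReducedWord.cons_iff.2
            ⟨by simp [(φ i).apply_star, hl1.1], by simpa using hij,
              IsReducedWord.cons_iff.2 ⟨hl2.1, by simp, .nil⟩⟩) (by simp)
          rw [← StarHomClass.map_star]
          simpa using this
        simpa [wordDefect, headDefect, h2, Pi.single_eq_of_ne hij] using h1

/-- The graph is completely positive and satisfies a Schwarz inequality. -/
theorem exists_mul_mem_wordGraph (h : IsFreeCPFamily φ embA EA ψ embD ED θ) {n : ℕ}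
    (z : Fin n → CA × CD) (hz : ∀ k, z k ∈ wordGraph φ embA embD θ) :
    ∃ Y : Fin n → Fin n → CD,
      (∀ k l, (star (z k).1 * (z l).1, Y k l) ∈ wordGraph φ embA embD θ) ∧
      ∀ c : Fin n → CD,
        0 ≤ ∑ k, ∑ l, star (c k) * (Y k l - star (z k).2 * (z l).2) * c l := by
  classical
  choose f hf using fun k => (Finsupp.mem_span_range_iff_exists_finsupp.1 (hz k))
  let K : {l // IsReducedWord φ l} → {l // IsReducedWord φ l} → CD :=
    fun l l' => wordDefect embA EA embD θ l l'
  have hK : IsPosKernel K := h.isPosKernel_wordDefect.comap _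
  refine ⟨fun k l => star (z k).2 * (z l).2 + kernelExtend K (f k) (f l), fun k l => ?_,
    fun c => by simpa using hK.kernelExtend n f c⟩
  have h1 : (star (z k).1 * (z l).1, star (z k).2 * (z l).2 + kernelExtend K (f k) (f l))
      = (f k).sum fun u a => (f l).sum fun v b => (star a * b) •
        (star (wordProd (fun i => embA i) u.1) * wordProd (fun i => embA i) v.1,
          star (wordProd (fun i a => embD i (θ i a)) u.1) *
            wordProd (fun i a => embD i (θ i a)) v.1 + K u v) := by
    rw [← hf k, ← hf l]
    simp only [Finsupp.sum, kernelExtend, Prod.ext_iff, Prod.fst_sum, Prod.snd_sum, Prod.smul_fst,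
      Prod.smul_snd, star_sum, star_smul, Finset.sum_mul, Finset.mul_sum, smul_mul_assoc,
      mul_smul_comm, smul_smul, smul_add, Finset.sum_add_distrib, Finset.smul_sum]
    constructor
    · rw [Finset.sum_comm]
      simp only [mul_comm]
    · rw [Finset.sum_comm]
      simp only [mul_comm]
  rw [h1]
  exact Submodule.sum_mem _ fun u _ => Submodule.sum_mem _ fun v _ => Submodule.smul_mem _ _
    (h.mul_mem_wordGraph u.2 v.2)

end IsFreeCPFamily

end Graph

section Contraction

variable {I : Type*} {A D : I → Type*}
  [∀ i, CStarAlgebra (A i)] [∀ i, PartialOrder (A i)] [∀ i, StarOrderedRing (A i)]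
  [∀ i, CStarAlgebra (D i)] [∀ i, PartialOrder (D i)] [∀ i, StarOrderedRing (D i)]
  {CA CD : Type*} [CStarAlgebra CA] [PartialOrder CA] [StarOrderedRing CA]
  [CStarAlgebra CD] [PartialOrder CD] [StarOrderedRing CD]
  {φ : ∀ i, A i →ₚ[ℂ] ℂ} {embA : ∀ i, A i →⋆ₐ[ℂ] CA} {EA : CA →ₚ[ℂ] ℂ}
  {ψ : ∀ i, D i →ₚ[ℂ] ℂ} {embD : ∀ i, D i →⋆ₐ[ℂ] CD} {ED : CD →ₚ[ℂ] ℂ}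
  {θ : ∀ i, A i →ₗ[ℂ] D i}

namespace IsFreeCPFamily

theorem emb_mem_wordGraph (h : IsFreeCPFamily φ embA EA ψ embD ED θ) (i : I) (a : A i) :
    (embA i a, embD i (θ i a)) ∈ wordGraph φ embA embD θ := by
  obtain ⟨z, hz, hza⟩ := h.freeA.exists_center i a
  have h1 := wordProd_mem_wordGraph (embA := embA) (embD := embD) (θ := θ)
    (IsReducedWord.nil (φ := φ))
  have h2 := wordProd_mem_wordGraph (embA := embA) (embD := embD) (θ := θ)
    (l := [⟨i, z⟩]) (IsReducedWord.cons_iff.2 ⟨hz, by simp, .nil⟩)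
  convert Submodule.add_mem _ h2 (Submodule.smul_mem _ (φ i a) h1) using 1
  conv_lhs => rw [hza]
  simp [h.map_one]

theorem one_mem_wordGraph :
    ((1, 1) : CA × CD) ∈ wordGraph φ embA embD θ := by
  simpa using wordProd_mem_wordGraph (embA := embA) (embD := embD) (θ := θ)
    (IsReducedWord.nil (φ := φ))

theorem emb_mul_mul_emb_mem_wordGraph (h : IsFreeCPFamily φ embA EA ψ embD ED θ) {i : I}
    {b : List (Σ i, A i)} (hb : IsReducedWord φ b) (hne : b ≠ [])
    (hbh : ∀ p ∈ b.head?, i ≠ p.1) (hbl : ∀ p ∈ b.getLast?, i ≠ p.1) (a a' : A i) :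
    (embA i a * wordProd (fun i => embA i) b * embA i a',
      embD i (θ i a) * wordProd (fun i a => embD i (θ i a)) b * embD i (θ i a')) ∈
        wordGraph φ embA embD θ := by
  obtain ⟨z, hz, hza⟩ := h.freeA.exists_center i a
  obtain ⟨z', hz', hza'⟩ := h.freeA.exists_center i a'
  have hz1 : IsReducedWord φ [⟨i, z⟩] := IsReducedWord.cons_iff.2 ⟨hz, by simp, .nil⟩
  have hz1' : IsReducedWord φ [⟨i, z'⟩] := IsReducedWord.cons_iff.2 ⟨hz', by simp, .nil⟩
  have hzb : IsReducedWord φ (⟨i, z⟩ :: b) := IsReducedWord.cons_iff.2 ⟨hz, hbh, hb⟩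
  have hbz : IsReducedWord φ (b ++ [⟨i, z'⟩]) :=
    IsReducedWord.append_iff.2 ⟨hb, hz1', by simpa [eq_comm] using hbl⟩
  have hzbz : IsReducedWord φ (⟨i, z⟩ :: (b ++ [⟨i, z'⟩])) :=
    IsReducedWord.cons_iff.2 ⟨hz, by rwa [List.head?_append_of_ne_nil _ hne], hbz⟩
  have mem := fun l hl => wordProd_mem_wordGraph (embA := embA) (embD := embD) (θ := θ)
    (φ := φ) (l := l) hl
  convert Submodule.add_mem _ (Submodule.add_mem _ (mem _ hzbz)
    (Submodule.smul_mem _ (φ i a') (mem _ hzb))) (Submodule.add_mem _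
    (Submodule.smul_mem _ (φ i a) (mem _ hbz))
    (Submodule.smul_mem _ (φ i a * φ i a') (mem _ hb))) using 1
  have hA : embA i a = embA i z + φ i a • 1 := by
    conv_lhs => rw [hza, map_add, map_smul, _root_.map_one]
  have hA' : embA i a' = embA i z' + φ i a' • 1 := by
    conv_lhs => rw [hza', map_add, map_smul, _root_.map_one]
  have hD : embD i (θ i a) = embD i (θ i z) + φ i a • 1 := by
    conv_lhs => rw [hza, map_add, map_smul, h.map_one, map_add, map_smul, _root_.map_one]
  have hD' : embD i (θ i a') = embD i (θ i z') + φ i a' • 1 := by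
    conv_lhs => rw [hza', map_add, map_smul, h.map_one, map_add, map_smul, _root_.map_one]
  rw [hA, hA', hD, hD']
  ext <;> simp [add_mul, mul_add, smul_smul, mul_assoc, add_assoc, mul_comm (φ i a')] <;> abel

theorem denseRange_fst (h : IsFreeCPFamily φ embA EA ψ embD ED θ) :
    DenseRange (LinearMap.fst ℂ CA CD ∘ₗ (wordGraph φ embA embD θ).subtype) := by
  have h1 := h.freeA.dense_span_wordProd
  rw [DenseRange]
  convert h1
  rw [← LinearMap.coe_range, LinearMap.range_comp, Submodule.range_subtype, wordGraph,
    Submodule.map_span, ← Set.range_comp]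
  rfl

/-- If a vector functional of `D` is bounded on the graph, it induces a positive functional. -/
theorem exists_positive_of_bounded (h : IsFreeCPFamily φ embA EA ψ embD ED θ) {e : CD}
    (he : ∃ K, ∀ p ∈ wordGraph φ embA embD θ, ‖ED (star e * p.2 * e)‖ ≤ K * ‖p.1‖) :
    ∃ F : CA →ₚ[ℂ] ℂ, ∀ p ∈ wordGraph φ embA embD θ, F p.1 = ED (star e * p.2 * e) := by
  obtain ⟨K, hK⟩ := he
  let P := wordGraph φ embA embD θ
  let fst : P →ₗ[ℂ] CA := LinearMap.fst ℂ CA CD ∘ₗ P.subtype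
  let f : P →ₗ[ℂ] ℂ := ED.toLinearMap ∘ₗ LinearMap.mulRight ℂ e ∘ₗ LinearMap.mulLeft ℂ (star e) ∘ₗ
    LinearMap.snd ℂ CA CD ∘ₗ P.subtype
  have hF : ∀ p ∈ P, f.extendOfNorm fst p.1 = ED (star e * p.2 * e) := fun p hp =>
    LinearMap.extendOfNorm_eq (f := f) (e := fst) h.denseRange_fst ⟨K, fun q => hK q.1 q.2⟩ ⟨p, hp⟩
  have hpos : ∀ x, 0 ≤ f.extendOfNorm fst (star x * x) := fun x => by
    refine h.denseRange_fst.induction_on (p := fun x => 0 ≤ f.extendOfNorm fst (star x * x)) x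
      (isClosed_le continuous_const (by fun_prop)) fun p => ?_
    obtain ⟨Y, hY, hpos⟩ := h.exists_mul_mem_wordGraph (n := 1) (fun _ => p.1) fun _ => p.2
    have h1 := hF _ (hY 0 0)
    have h2 := hpos fun _ => e
    simp only [Finset.univ_unique, Fin.default_eq_zero, Finset.sum_singleton] at h2
    have h3 : 0 ≤ star e * Y 0 0 * e := by
      refine (star_mul_self_nonneg (p.1.2 * e)).trans (sub_nonneg.1 (h2.trans_eq ?_))
      simp [mul_sub, sub_mul, mul_assoc]
    exact (ED.map_nonneg h3).trans_eq h1.symm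
  exact ⟨PositiveLinearMap.mk₀ (f.extendOfNorm fst).toLinearMap fun x hx => by
    obtain ⟨s, rfl⟩ := CStarAlgebra.nonneg_iff_eq_star_mul_self.1 hx
    exact hpos s, hF⟩

theorem norm_toPreGNS_mul_le (h : IsFreeCPFamily φ embA EA ψ embD ED θ) {e : CD}
    (he : ∃ K, ∀ p ∈ wordGraph φ embA embD θ, ‖ED (star e * p.2 * e)‖ ≤ K * ‖p.1‖) {p : CA × CD}
    (hp : p ∈ wordGraph φ embA embD θ) :
    ‖ED.toPreGNS (p.2 * e)‖ ≤ ‖p.1‖ * ‖ED.toPreGNS e‖ := by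
  obtain ⟨F, hF⟩ := h.exists_positive_of_bounded he
  obtain ⟨Y, hY, hpos⟩ := h.exists_mul_mem_wordGraph (n := 1) (fun _ => p) fun _ => hp
  have h1 := hF _ (hY 0 0)
  have h2 := hpos fun _ => e
  simp only [Finset.univ_unique, Fin.default_eq_zero, Finset.sum_singleton] at h1 h2
  have h3 : star (p.2 * e) * (p.2 * e) ≤ star e * Y 0 0 * e := by
    refine sub_nonneg.1 (h2.trans_eq ?_)
    simp [mul_sub, sub_mul, mul_assoc]
  have h4 := OrderHomClass.mono ED h3
  have h5 := hF _ one_mem_wordGraph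
  have h6 := F.apply_star_mul_self 1
  simp only [star_one, mul_one] at h5 h6
  rw [← h1, F.apply_star_mul_self, ED.apply_star_mul_self, Complex.real_le_real] at h4
  rw [h6, ED.apply_star_mul_self, Complex.ofReal_inj] at h5
  have h7 := abs_le_of_sq_le_sq' h4 (norm_nonneg _)
  have h8 : ‖F.toPreGNS 1‖ = ‖ED.toPreGNS e‖ :=
    (pow_left_inj₀ (norm_nonneg _) (norm_nonneg _) two_ne_zero).1 h5
  rw [← h8]
  exact h7.2.trans (F.norm_toPreGNS_one_mul_le p.1)

theorem norm_apply_conj_le (h : IsFreeCPFamily φ embA EA ψ embD ED θ) {i : I}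
    {d : List (Σ i, D i)} (hd : IsReducedWord ψ d) (hi : ∀ p ∈ d.head?, i ≠ p.1)
    (he : ∃ K, ∀ p ∈ wordGraph φ embA embD θ,
      ‖ED (star (wordProd (fun i => embD i) d) * p.2 * wordProd (fun i => embD i) d)‖ ≤
        K * ‖p.1‖) (x : CA) (c : A i) (y : CD)
    (hy : (star (embA i c) * x * embA i c, y) ∈ wordGraph φ embA embD θ) :
    ‖ED (star (wordProd (fun i => embD i) d) * y * wordProd (fun i => embD i) d)‖ ≤
      ‖x‖ * (‖(φ i).toPreGNS c‖ ^ 2 * ‖ED.toPreGNS (wordProd (fun i => embD i) d)‖ ^ 2) := by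
  obtain ⟨F, hF⟩ := h.exists_positive_of_bounded he
  have h1 := hF _ (h.emb_mem_wordGraph i (star c * c))
  simp only [h.freeD.apply_conj_emb hd hi, h.compat] at h1
  rw [map_mul, StarHomClass.map_star, F.apply_star_mul_self, (φ i).apply_star_mul_self,
    ED.apply_star_mul_self, ← Complex.ofReal_mul, Complex.ofReal_inj] at h1
  rw [← hF _ hy, ← h1, mul_assoc]
  calc _ ≤ ‖F.toPreGNS (embA i c)‖ * ‖F.toPreGNS (x * embA i c)‖ := F.norm_apply_star_mul_le _ _
    _ ≤ ‖F.toPreGNS (embA i c)‖ * (‖x‖ * ‖F.toPreGNS (embA i c)‖) := by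
      gcongr; exact F.norm_toPreGNS_mul_le _ _
    _ = _ := by ring

end IsFreeCPFamily

theorem IsReducedWord.exists_eq_emb_mul_mul_emb (h : IsFreeCPFamily φ embA EA ψ embD ED θ) (i : I)
    {l : List (Σ i, A i)} (hl : IsReducedWord φ l) :
    (∃ a : A i, wordProd (fun i => embA i) l = embA i a ∧
      wordProd (fun i a => embD i (θ i a)) l = embD i (θ i a)) ∨
    ∃ (a a' : A i) (b : List (Σ i, A i)), IsReducedWord φ b ∧ b ≠ [] ∧
      (∀ p ∈ b.head?, i ≠ p.1) ∧ (∀ p ∈ b.getLast?, i ≠ p.1) ∧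
      wordProd (fun i => embA i) l = embA i a * wordProd (fun i => embA i) b * embA i a' ∧
      wordProd (fun i a => embD i (θ i a)) l =
        embD i (θ i a) * wordProd (fun i a => embD i (θ i a)) b * embD i (θ i a') := by
  have right : ∀ b : List (Σ i, A i), IsReducedWord φ b → b ≠ [] → (∀ p ∈ b.head?, i ≠ p.1) →
      ∃ (a' : A i) (b' : List (Σ i, A i)), IsReducedWord φ b' ∧ b' ≠ [] ∧
      (∀ p ∈ b'.head?, i ≠ p.1) ∧ (∀ p ∈ b'.getLast?, i ≠ p.1) ∧
      wordProd (fun i => embA i) b = wordProd (fun i => embA i) b' * embA i a' ∧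
      wordProd (fun i a => embD i (θ i a)) b =
        wordProd (fun i a => embD i (θ i a)) b' * embD i (θ i a') := by
    intro b hb hne hbh
    rcases List.eq_nil_or_concat b with rfl | ⟨b, ⟨j, β⟩, rfl⟩
    · exact absurd rfl hne
    rw [List.concat_eq_append] at hb hbh ⊢
    by_cases hij : i = j
    · subst hij
      have hb' := IsReducedWord.append_iff.1 hb
      have hne' : b ≠ [] := by
        rintro rfl
        simp at hbh
      exact ⟨β, b, hb'.1, hne', by rwa [List.head?_append_of_ne_nil _ hne'] at hbh,
        by simpa [eq_comm] using hb'.2.2, by simp, by simp⟩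
    · exact ⟨1, b ++ [⟨j, β⟩], hb, by simp, hbh, by simpa using hij, by simp, by simp [h.map_one]⟩
  rcases l with _ | ⟨⟨j, α⟩, l⟩
  · exact Or.inl ⟨1, by simp, by simp [h.map_one]⟩
  by_cases hij : i = j
  · subst hij
    have hl' := IsReducedWord.cons_iff.1 hl
    rcases eq_or_ne l [] with rfl | hne
    · exact Or.inl ⟨α, by simp, by simp⟩
    obtain ⟨a', b, hb, hbne, hbh, hbl, h1, h2⟩ := right l hl'.2.2 hne hl'.2.1
    exact Or.inr ⟨α, a', b, hb, hbne, hbh, hbl, by simp [h1, mul_assoc], by simp [h2, mul_assoc]⟩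
  · obtain ⟨a', b, hb, hbne, hbh, hbl, h1, h2⟩ := right _ hl (by simp) (by simpa using hij)
    exact Or.inr ⟨1, a', b, hb, hbne, hbh, hbl, by simp [h1], by simp [h2, h.map_one]⟩

end Contraction

section FreeProductMap

variable {I : Type*} {A D : I → Type*}
  [∀ i, CStarAlgebra (A i)] [∀ i, PartialOrder (A i)] [∀ i, StarOrderedRing (A i)]
  [∀ i, CStarAlgebra (D i)] [∀ i, PartialOrder (D i)] [∀ i, StarOrderedRing (D i)]
  {CA CD : Type*} [CStarAlgebra CA] [PartialOrder CA] [StarOrderedRing CA]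
  [CStarAlgebra CD] [PartialOrder CD] [StarOrderedRing CD]
  {φ : ∀ i, A i →ₚ[ℂ] ℂ} {embA : ∀ i, A i →⋆ₐ[ℂ] CA} {EA : CA →ₚ[ℂ] ℂ}
  {ψ : ∀ i, D i →ₚ[ℂ] ℂ} {embD : ∀ i, D i →⋆ₐ[ℂ] CD} {ED : CD →ₚ[ℂ] ℂ}
  {θ : ∀ i, A i →ₗ[ℂ] D i}

namespace IsFreeCPFamily

/-- The compression of an element of the graph to the algebra `A i`, and the effect on the graph of
changing the first letter of a vector. -/
theorem exists_compression (h : IsFreeCPFamily φ embA EA ψ embD ED θ) {i : I}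
    {d : List (Σ i, D i)} (hd : IsReducedWord ψ d) (hi : ∀ p ∈ d.head?, i ≠ p.1) (δ : D i)
    {p : CA × CD} (hp : p ∈ wordGraph φ embA embD θ) :
    ∃ (z : A i) (F : Finset (A i)),
      (∀ α α' : A i, EA (embA i α * p.1 * embA i α') = φ i (α * z * α')) ∧
      ∀ c : A i, (∀ a ∈ F, φ i (star c * a) = ψ i (star δ * θ i a) ∧
          φ i (a * c) = ψ i (θ i a * δ)) →
        ∃ y, (star (embA i c) * p.1 * embA i c, y) ∈ wordGraph φ embA embD θ ∧
          ED (star (wordProd (fun i => embD i) d) * (star (embD i δ) * p.2 * embD i δ) *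
              wordProd (fun i => embD i) d) =
            ED (star (wordProd (fun i => embD i) d) * y * wordProd (fun i => embD i) d) +
              (ψ i (star δ * θ i z * δ) - φ i (star c * z * c)) *
                ED (star (wordProd (fun i => embD i) d) * wordProd (fun i => embD i) d) := by
  classical
  induction hp using Submodule.span_induction with
  | zero => exact ⟨0, ∅, by simp, fun c _ => ⟨0, by simp [← Prod.zero_eq_mk], by simp⟩⟩
  | add p p' _ _ h1 h2 =>
    obtain ⟨z, F, hz, hF⟩ := h1
    obtain ⟨z', F', hz', hF'⟩ := h2
    refine ⟨z + z', F ∪ F', fun α α' => by simp [mul_add, add_mul, hz, hz'], fun c hc => ?_⟩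
    obtain ⟨y, hy, hy1⟩ := hF c fun a ha => hc a (Finset.mem_union_left _ ha)
    obtain ⟨y', hy', hy1'⟩ := hF' c fun a ha => hc a (Finset.mem_union_right _ ha)
    refine ⟨y + y', by simpa [mul_add, add_mul] using Submodule.add_mem _ hy hy', ?_⟩
    simp only [Prod.snd_add, mul_add, add_mul, map_add, hy1, hy1']
    ring
  | smul r p _ h1 =>
    obtain ⟨z, F, hz, hF⟩ := h1
    refine ⟨r • z, F, fun α α' => by simp [hz], fun c hc => ?_⟩
    obtain ⟨y, hy, hy1⟩ := hF c hc
    refine ⟨r • y, by simpa using Submodule.smul_mem _ r hy, ?_⟩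
    simp only [Prod.smul_snd, mul_smul_comm, smul_mul_assoc, map_smul, hy1, smul_eq_mul]
    ring
  | mem p hp =>
    obtain ⟨⟨l, hl⟩, rfl⟩ := hp
    rcases hl.exists_eq_emb_mul_mul_emb h i with
      ⟨a, h1, h2⟩ | ⟨a, a', b, hb, hne, hbh, hbl, h1, h2⟩
    · refine ⟨a, ∅, fun α α' => ?_, fun c _ =>
        ⟨embD i (θ i (star c * a * c)), ?_, ?_⟩⟩
      · simp only [h1]
        rw [← map_mul, ← map_mul, h.freeA.restrict]
      · simp only [h1]
        rw [← StarHomClass.map_star, ← map_mul, ← map_mul]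
        exact h.emb_mem_wordGraph i _
      · simp only [h2]
        rw [← StarHomClass.map_star, ← map_mul, ← map_mul, h.freeD.apply_conj_emb hd hi,
          h.freeD.apply_conj_emb hd hi, h.compat]
        ring
    · refine ⟨0, {a, a'}, fun α α' => ?_, fun c hc =>
        ⟨embD i (θ i (star c * a)) * wordProd (fun i a => embD i (θ i a)) b *
          embD i (θ i (a' * c)), ?_, ?_⟩⟩
      · have h3 := h.freeA.apply_conj_emb_mul_mul_emb (d := []) (i := i) .nil (by simp) hb hne hbh
          hbl (α * a) (a' * α')
        simp only [wordProd_nil, star_one, one_mul, mul_one, h.freeA.free b hb hne, mul_zero,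
          map_mul] at h3
        simpa [h1, mul_assoc] using h3
      · convert h.emb_mul_mul_emb_mem_wordGraph hb hne hbh hbl (star c * a) (a' * c) using 2
        simp only [h1, map_mul, StarHomClass.map_star, mul_assoc]
      · have hb' := hb.mapWord (θ := fun i => θ i) h.compat
        have hne' : mapWord (fun i => θ i) b ≠ [] := by simpa [mapWord] using hne
        have hbh' : ∀ p ∈ (mapWord (fun i => θ i) b).head?, i ≠ p.1 := by
          simp only [mapWord, List.head?_map, Option.mem_def, Option.map_eq_some_iff]
          rintro _ ⟨q, hq, rfl⟩
          exact hbh q hq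
        have hbl' : ∀ p ∈ (mapWord (fun i => θ i) b).getLast?, i ≠ p.1 := by
          simp only [mapWord, List.getLast?_map, Option.mem_def, Option.map_eq_some_iff]
          rintro _ ⟨q, hq, rfl⟩
          exact hbl q hq
        have h3 := h.freeD.apply_conj_emb_mul_mul_emb hd hi hb' hne' hbh' hbl'
        simp only [wordProd_mapWord] at h3
        have h4 : star (embD i δ) * (embD i (θ i a) * wordProd (fun i a => embD i (θ i a)) b *
            embD i (θ i a')) * embD i δ = embD i (star δ * θ i a) *
              wordProd (fun i a => embD i (θ i a)) b * embD i (θ i a' * δ) := by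
          simp only [map_mul, StarHomClass.map_star, mul_assoc]
        simp only [h2]
        rw [h4, h3, h3, h.compat, h.compat, (hc a (by simp)).1, (hc a' (by simp)).2]
        simp

theorem norm_toPreGNS_map_le (h : IsFreeCPFamily φ embA EA ψ embD ED θ) (i : I) (a : A i) :
    ‖(ψ i).toPreGNS (θ i a)‖ ≤ ‖(φ i).toPreGNS a‖ := by
  have h1 := ((h.cp i).isPosKernel_sub (h.map_one i) (h.map_star i)).self_nonneg a
  have h2 := OrderHomClass.mono (ψ i) (sub_nonneg.1 h1)
  rw [h.compat, (ψ i).apply_star_mul_self, (φ i).apply_star_mul_self, Complex.real_le_real] at h2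
  exact (abs_le_of_sq_le_sq' h2 (norm_nonneg _)).2

theorem norm_compression_le (h : IsFreeCPFamily φ embA EA ψ embD ED θ) {i : I} {x : CA} {z : A i}
    (hz : ∀ α α' : A i, EA (embA i α * x * embA i α') = φ i (α * z * α')) : ‖z‖ ≤ ‖x‖ := by
  have hn : ∀ a : A i, ‖EA.toPreGNS (embA i a)‖ = ‖(φ i).toPreGNS a‖ := fun a => by
    have h1 := h.freeA.restrict i (star a * a)
    rw [map_mul, StarHomClass.map_star, EA.apply_star_mul_self, (φ i).apply_star_mul_self,
      Complex.ofReal_inj] at h1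
    exact (pow_left_inj₀ (norm_nonneg _) (norm_nonneg _) two_ne_zero).1 h1
  refine norm_le_of_faithfulGNS (h.faithfulA i) (norm_nonneg x) fun α => ?_
  have h1 : φ i (star (z * α) * (z * α)) = EA (star (embA i (z * α)) * (x * embA i α)) := by
    rw [← StarHomClass.map_star, ← mul_assoc (embA i _), hz, mul_assoc]
  have h2 : ‖(φ i).toPreGNS (z * α)‖ * ‖(φ i).toPreGNS (z * α)‖ ≤
      ‖(φ i).toPreGNS (z * α)‖ * (‖x‖ * ‖(φ i).toPreGNS α‖) := by
    calc _ = ‖φ i (star (z * α) * (z * α))‖ := by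
          rw [(φ i).apply_star_mul_self, Complex.norm_real, norm_pow, norm_norm, sq]
      _ ≤ ‖EA.toPreGNS (embA i (z * α))‖ * ‖EA.toPreGNS (x * embA i α)‖ := by
          rw [h1]; exact EA.norm_apply_star_mul_le _ _
      _ ≤ _ := by
          rw [hn, ← hn α]
          gcongr
          exact EA.norm_toPreGNS_mul_le _ _
  rcases (norm_nonneg ((φ i).toPreGNS (z * α))).eq_or_lt with h0 | h0
  · rw [← h0]; positivity
  · exact le_of_mul_le_mul_left h2 h0

theorem exists_bound_cons (h : IsFreeCPFamily φ embA EA ψ embD ED θ) {i : I}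
    {d : List (Σ i, D i)} (hd : IsReducedWord ψ d) (hi : ∀ p ∈ d.head?, i ≠ p.1) (δ : D i)
    (he : ∃ K, ∀ p ∈ wordGraph φ embA embD θ,
      ‖ED (star (wordProd (fun i => embD i) d) * p.2 * wordProd (fun i => embD i) d)‖ ≤
        K * ‖p.1‖) :
    ∃ K, ∀ p ∈ wordGraph φ embA embD θ,
      ‖ED (star (wordProd (fun i => embD i) (⟨i, δ⟩ :: d)) * p.2 *
        wordProd (fun i => embD i) (⟨i, δ⟩ :: d))‖ ≤ K * ‖p.1‖ := by
  classical
  obtain ⟨C, hC⟩ := (h.cp i).toPositiveLinearMap.exists_norm_apply_le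
  set N := ‖ED.toPreGNS (wordProd (fun i => embD i) d)‖ ^ 2 with hN
  set M := ‖(ψ i).toPreGNS δ‖ with hM
  refine ⟨M ^ 2 * N + (M * C * M + M ^ 2) * N, fun p hp => ?_⟩
  obtain ⟨z, F, hz, hF⟩ := h.exists_compression hd hi δ hp
  obtain ⟨c, hcM, hc⟩ := (φ i).exists_apply_star_mul_eq
    ((ψ i).toLinearMap ∘ₗ LinearMap.mulLeft ℂ (star δ) ∘ₗ θ i) (norm_nonneg _)
    (fun a => ((ψ i).norm_apply_star_mul_le δ (θ i a)).trans
      (mul_le_mul_of_nonneg_left (h.norm_toPreGNS_map_le i a) (norm_nonneg _)))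
    (F ∪ F.image star)
  have hc1 : ∀ a ∈ F ∪ F.image star, φ i (star c * a) = ψ i (star δ * θ i a) := hc
  obtain ⟨y, hy, hy1⟩ := hF c fun a ha => by
    refine ⟨hc1 a (Finset.mem_union_left _ ha), ?_⟩
    have h1 := hc1 (star a) (Finset.mem_union_right _ (Finset.mem_image_of_mem _ ha))
    rw [← star_inj, ← (φ i).apply_star, ← (ψ i).apply_star] at h1
    simpa [h.map_star] using h1
  have hzx := h.norm_compression_le hz
  have h1 : ‖ED (star (wordProd (fun i => embD i) d) * y * wordProd (fun i => embD i) d)‖ ≤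
      ‖p.1‖ * (M ^ 2 * N) :=
    (h.norm_apply_conj_le hd hi he p.1 c y hy).trans (by gcongr)
  have h2 : ‖ψ i (star δ * θ i z * δ)‖ ≤ M * C * M * ‖p.1‖ := by
    rw [mul_assoc]
    calc _ ≤ M * ‖(ψ i).toPreGNS (θ i z * δ)‖ := (ψ i).norm_apply_star_mul_le _ _
      _ ≤ M * (‖θ i z‖ * M) := by gcongr; exact (ψ i).norm_toPreGNS_mul_le _ _
      _ ≤ M * (C * ‖p.1‖ * M) := by
        gcongr
        exact (hC z).trans (by gcongr)
      _ = _ := by ring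
  have h3 : ‖φ i (star c * z * c)‖ ≤ M ^ 2 * ‖p.1‖ := by
    rw [mul_assoc]
    calc _ ≤ ‖(φ i).toPreGNS c‖ * ‖(φ i).toPreGNS (z * c)‖ := (φ i).norm_apply_star_mul_le _ _
      _ ≤ ‖(φ i).toPreGNS c‖ * (‖z‖ * ‖(φ i).toPreGNS c‖) := by
        gcongr; exact (φ i).norm_toPreGNS_mul_le _ _
      _ ≤ M * (‖p.1‖ * M) := by gcongr
      _ = _ := by ring
  have h4 : ‖ED (star (wordProd (fun i => embD i) d) * wordProd (fun i => embD i) d)‖ = N := by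
    rw [ED.apply_star_mul_self, Complex.norm_real, norm_pow, norm_norm]
  have h5 : ED (star (wordProd (fun i => embD i) (⟨i, δ⟩ :: d)) * p.2 *
        wordProd (fun i => embD i) (⟨i, δ⟩ :: d)) =
      ED (star (wordProd (fun i => embD i) d) * (star (embD i δ) * p.2 * embD i δ) *
              wordProd (fun i => embD i) d) := by
    simp only [wordProd_cons, star_mul, mul_assoc]
  rw [h5, hy1]
  calc _ ≤ ‖p.1‖ * (M ^ 2 * N) + (M * C * M * ‖p.1‖ + M ^ 2 * ‖p.1‖) * N := by
        refine (norm_add_le _ _).trans (add_le_add h1 ?_)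
        rw [norm_mul, h4]
        gcongr
        exact (norm_sub_le _ _).trans (add_le_add h2 h3)
    _ = _ := by ring

theorem apply_eq_of_mem_wordGraph (h : IsFreeCPFamily φ embA EA ψ embD ED θ) {p : CA × CD}
    (hp : p ∈ wordGraph φ embA embD θ) : ED p.2 = EA p.1 := by
  induction hp using Submodule.span_induction with
  | zero => simp
  | add p p' _ _ h1 h2 => simp [h1, h2]
  | smul r p _ h1 => simp [h1]
  | mem p hp =>
    obtain ⟨⟨l, hl⟩, rfl⟩ := hp
    rcases eq_or_ne l [] with rfl | hne
    · simp [h.freeA.map_one, h.freeD.map_one]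
    · have h1 := h.freeD.free _ (hl.mapWord (θ := fun i => θ i) h.compat)
        (by simpa [mapWord] using hne)
      rw [wordProd_mapWord] at h1
      simp only [h1, h.freeA.free l hl hne]

theorem exists_bound_wordProd (h : IsFreeCPFamily φ embA EA ψ embD ED θ)
    {d : List (Σ i, D i)} (hd : IsReducedWord ψ d) :
    ∃ K, ∀ p ∈ wordGraph φ embA embD θ,
      ‖ED (star (wordProd (fun i => embD i) d) * p.2 * wordProd (fun i => embD i) d)‖ ≤
        K * ‖p.1‖ := by
  induction d with
  | nil =>
    obtain ⟨C, hC⟩ := EA.exists_norm_apply_le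
    exact ⟨C, fun p hp => by simpa [h.apply_eq_of_mem_wordGraph hp] using hC p.1⟩
  | cons q d ih =>
    have hd' := IsReducedWord.cons_iff.1 hd
    exact h.exists_bound_cons hd'.2.2 hd'.2.1 q.2 (ih hd'.2.2)

theorem norm_snd_le (h : IsFreeCPFamily φ embA EA ψ embD ED θ) {p : CA × CD}
    (hp : p ∈ wordGraph φ embA embD θ) : ‖p.2‖ ≤ ‖p.1‖ := by
  have key : ∀ e ∈ Submodule.span ℂ (Set.range fun l : {l // IsReducedWord ψ l} =>
      wordProd (fun i => embD i) l.1),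
      ∃ K, ∀ p ∈ wordGraph φ embA embD θ, ‖ED.toPreGNS (p.2 * e)‖ ≤ K * ‖p.1‖ := fun e he => by
    induction he using Submodule.span_induction with
    | zero => exact ⟨0, by simp⟩
    | add e e' _ _ h1 h2 =>
      obtain ⟨K, hK⟩ := h1
      obtain ⟨K', hK'⟩ := h2
      refine ⟨K + K', fun p hp => ?_⟩
      rw [mul_add, map_add, add_mul]
      exact (norm_add_le _ _).trans (add_le_add (hK p hp) (hK' p hp))
    | smul r e _ h1 =>
      obtain ⟨K, hK⟩ := h1
      refine ⟨‖r‖ * K, fun p hp => ?_⟩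
      rw [mul_smul_comm, map_smul, norm_smul, mul_assoc]
      exact mul_le_mul_of_nonneg_left (hK p hp) (norm_nonneg r)
    | mem e he =>
      obtain ⟨⟨d, hd⟩, rfl⟩ := he
      refine ⟨‖ED.toPreGNS (wordProd (fun i => embD i) d)‖, fun p hp => ?_⟩
      rw [mul_comm]
      exact h.norm_toPreGNS_mul_le (h.exists_bound_wordProd hd) hp
  refine norm_le_of_faithfulGNS h.freeD.faithful (norm_nonneg _) fun e => ?_
  refine h.freeD.dense_span_wordProd.induction (P := fun e =>
    ‖ED.toPreGNS (p.2 * e)‖ ≤ ‖p.1‖ * ‖ED.toPreGNS e‖) (fun e he => ?_) ?_ e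
  · obtain ⟨K, hK⟩ := key e he
    refine h.norm_toPreGNS_mul_le ⟨‖ED.toPreGNS e‖ * K, fun p hp => ?_⟩ hp
    rw [mul_assoc (star e), mul_assoc]
    exact (ED.norm_apply_star_mul_le e (p.2 * e)).trans
      (mul_le_mul_of_nonneg_left (hK p hp) (norm_nonneg _))
  · exact isClosed_le
      (ED.continuous_toPreGNS.comp (continuous_const.mul continuous_id)).norm
      (continuous_const.mul ED.continuous_toPreGNS.norm)

/-- The reduced free product of state-preserving unital completely positive maps. -/
theorem exists_completelyPositive (h : IsFreeCPFamily φ embA EA ψ embD ED θ) :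
    ∃ Θ : CA →ₗ[ℂ] CD, IsCompletelyPositive Θ ∧ ∀ p ∈ wordGraph φ embA embD θ, Θ p.1 = p.2 := by
  let P := wordGraph φ embA embD θ
  let fst : P →ₗ[ℂ] CA := LinearMap.fst ℂ CA CD ∘ₗ P.subtype
  let snd : P →ₗ[ℂ] CD := LinearMap.snd ℂ CA CD ∘ₗ P.subtype
  let Θ := snd.extendOfNorm fst
  have hΘ : ∀ p ∈ P, Θ p.1 = p.2 := fun p hp =>
    LinearMap.extendOfNorm_eq (f := snd) (e := fst) h.denseRange_fst
      ⟨1, fun q => (h.norm_snd_le q.2).trans_eq (one_mul _).symm⟩ ⟨p, hp⟩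
  refine ⟨Θ.toLinearMap, fun n a c => CStarAlgebra.nonneg_iff_eq_star_mul_self.1 ?_, hΘ⟩
  refine (DenseRange.piMap fun _ : Fin n => h.denseRange_fst).induction_on
    (p := fun a => 0 ≤ ∑ k, ∑ l, star (c k) * Θ (star (a k) * a l) * c l) a
    (isClosed_le continuous_const (by fun_prop)) fun p => ?_
  obtain ⟨Y, hY, hpos⟩ := h.exists_mul_mem_wordGraph (fun k => (p k).1) fun k => (p k).2
  have h1 : ∀ k l, Θ (star (p k).1.1 * (p l).1.1) = Y k l := fun k l => hΘ _ (hY k l)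
  have h2 : ∑ k, ∑ l, star (c k) * (star (p k).1.2 * (p l).1.2) * c l =
      star (∑ k, (p k).1.2 * c k) * ∑ k, (p k).1.2 * c k := by
    simp only [star_sum, star_mul, Finset.sum_mul, Finset.mul_sum, mul_assoc]
    exact Finset.sum_comm
  have h3 := hpos c
  simp only [mul_sub, sub_mul, Finset.sum_sub_distrib, h2] at h3
  refine (star_mul_self_nonneg _).trans ((sub_nonneg.1 h3).trans_eq ?_)
  simp only [← h1]
  rfl

end IsFreeCPFamily

end FreeProductMap

section Main

variable {C : Type*} [CStarAlgebra C] [PartialOrder C] [StarOrderedRing C]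

/-- A state as a positive linear functional. -/
def IsState.toPositiveLinearMap {φ : C →ₗ[ℂ] ℂ} (h : IsState φ) : C →ₚ[ℂ] ℂ :=
  PositiveLinearMap.mk₀ φ fun x hx => by
    obtain ⟨s, rfl⟩ := CStarAlgebra.nonneg_iff_eq_star_mul_self.1 hx
    obtain ⟨b, hb⟩ := h.positive s
    rw [hb]
    exact star_mul_self_nonneg b

theorem IsState.map_one {φ : C →ₗ[ℂ] ℂ} (h : IsState φ) : φ 1 = 1 := by
  simpa using h.left_inverse 1

variable {I : Type*} {A : I → Type*} [∀ i, CStarAlgebra (A i)] [∀ i, PartialOrder (A i)]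
  [∀ i, StarOrderedRing (A i)]

theorem isReducedWord_ofFn {φ : ∀ i, A i →ₚ[ℂ] ℂ} {n : ℕ} {ι : Fin (n + 1) → I}
    (hι : ∀ k : Fin n, ι k.castSucc ≠ ι k.succ) {a : (j : Fin (n + 1)) → A (ι j)}
    (ha : ∀ j, φ (ι j) (a j) = 0) :
    IsReducedWord φ (List.ofFn fun j => (⟨ι j, a j⟩ : Σ i, A i)) := by
  refine ⟨?_, ?_⟩
  · rw [List.isChain_ofFn]
    intro k hk
    exact hι ⟨k, by omega⟩
  · rintro _ hp
    obtain ⟨j, rfl⟩ := List.mem_ofFn.1 hp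
    exact ha j

theorem wordProd_ofFn (f : ∀ i, A i → C) {n : ℕ} (ι : Fin n → I) (a : (j : Fin n) → A (ι j)) :
    wordProd f (List.ofFn fun j => (⟨ι j, a j⟩ : Σ i, A i)) =
      (List.ofFn fun j => f (ι j) (a j)).prod := by
  simp [wordProd, List.map_ofFn, Function.comp_def]

theorem IsReducedAmalgProd.isFreeFamily {φ : ∀ i, A i →ₗ[ℂ] ℂ} (hφ : ∀ i, IsState (φ i))
    {emb : ∀ i, A i →⋆ₐ[ℂ] C} {E : C →ₗ[ℂ] ℂ}
    (h : IsReducedAmalgProd ℂ (fun i => StarAlgHom.ofId ℂ (A i)) φ (StarAlgHom.ofId ℂ C) emb E) :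
    IsFreeFamily (fun i => (hφ i).toPositiveLinearMap) emb
      (IsState.toPositiveLinearMap h.condExp) where
  map_one := IsState.map_one h.condExp
  restrict := h.restrict
  free l hl hne := by
    obtain ⟨n, hn⟩ := Nat.exists_eq_succ_of_ne_zero (mt List.length_eq_zero_iff.1 hne)
    have hk : ∀ k : Fin (n + 1), k.1 < l.length := fun k => by have := k.2; omega
    have h1 := h.free n (fun k => (l[k.1]'(hk k)).1)
      (fun k => List.isChain_iff_getElem.1 hl.1 k.1 (hk k.succ))
      (fun k => (l[k.1]'(hk k)).2) (fun k => hl.2 _ (List.getElem_mem _))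
    have h2 : l = List.ofFn fun k : Fin (n + 1) =>
        (⟨(l[k.1]'(hk k)).1, (l[k.1]'(hk k)).2⟩ : Σ i, A i) :=
      List.ext_getElem (by rw [List.length_ofFn, hn]) fun k _ _ => by rw [List.getElem_ofFn]
    rw [← wordProd_ofFn (fun i => emb i) (fun k : Fin (n + 1) => (l[k.1]'(hk k)).1)
      fun k => (l[k.1]'(hk k)).2, ← h2] at h1
    exact h1
  faithful := h.faithful
  generating := h.generating

end Main

/-- **Theorem (Choda; reduced free products of completely positive maps).**  Let `I` be
a set, and for every `i ∈ I` let `θi i : A i → D i` be a unital completely positive map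
between unital C⋆-algebras, let `φ i` and `ψ i` be states on `A i` and `D i`
respectively, each having faithful GNS representation, and suppose `ψ i ∘ θi i = φ i`.
Let `(CA, EA) = *_{i ∈ I}(A i, φ i)` and `(CD, ED) = *_{i ∈ I}(D i, ψ i)` be the reduced
free products of C⋆-algebras.  Then there is a unital completely positive map
`θ : CA → CD` such that the restriction of `θ` to the canonical copy of `A i` in `CA`
equals `θi i` followed by the canonical embedding `D i ↪ CD` for every `i ∈ I`, and such
that `θ (a 1 * ⋯ * a n) = θ (a 1) * ⋯ * θ (a n)` whenever `a j ∈ A (ι j)` with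
`φ (ι j) (a j) = 0` and `ι 1 ≠ ι 2, …, ι (n-1) ≠ ι n`. -/
theorem exists_reducedFreeProd_ucp_map
    {I : Type*} (A D : I → Type*) [∀ i, CStarAlgebra (A i)] [∀ i, CStarAlgebra (D i)]
    (φ : ∀ i, A i →ₗ[ℂ] ℂ) (ψ : ∀ i, D i →ₗ[ℂ] ℂ)
    (hφ : ∀ i, IsState (φ i)) (hψ : ∀ i, IsState (ψ i))
    (hφfaith : ∀ i, FaithfulGNS (φ i)) (hψfaith : ∀ i, FaithfulGNS (ψ i))
    (θi : ∀ i, A i →ₗ[ℂ] D i)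
    (hcp : ∀ i, IsCompletelyPositive (θi i)) (hunital : ∀ i, θi i 1 = 1)
    (hcompat : ∀ i (a : A i), ψ i (θi i a) = φ i a)
    {CA : Type*} [CStarAlgebra CA] (embA : ∀ i, A i →⋆ₐ[ℂ] CA) (EA : CA →ₗ[ℂ] ℂ)
    (hprodA : IsReducedAmalgProd ℂ (fun i => StarAlgHom.ofId ℂ (A i)) φ
      (StarAlgHom.ofId ℂ CA) embA EA)
    {CD : Type*} [CStarAlgebra CD] (embD : ∀ i, D i →⋆ₐ[ℂ] CD) (ED : CD →ₗ[ℂ] ℂ)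
    (hprodD : IsReducedAmalgProd ℂ (fun i => StarAlgHom.ofId ℂ (D i)) ψ
      (StarAlgHom.ofId ℂ CD) embD ED) :
    ∃ θ : CA →ₗ[ℂ] CD,
      IsCompletelyPositive θ ∧ θ 1 = 1 ∧
      (∀ i (a : A i), θ (embA i a) = embD i (θi i a)) ∧
      (∀ (n : ℕ) (ι : Fin (n + 1) → I), (∀ k : Fin n, ι k.castSucc ≠ ι k.succ) →
        ∀ a : (j : Fin (n + 1)) → A (ι j), (∀ j, φ (ι j) (a j) = 0) →
          θ ((List.ofFn fun j => embA (ι j) (a j)).prod) =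
            (List.ofFn fun j => θ (embA (ι j) (a j))).prod) := by
  let : ∀ i, PartialOrder (A i) := fun _ => CStarAlgebra.spectralOrder _
  have : ∀ i, StarOrderedRing (A i) := fun _ => CStarAlgebra.spectralOrderedRing _
  let : ∀ i, PartialOrder (D i) := fun _ => CStarAlgebra.spectralOrder _
  have : ∀ i, StarOrderedRing (D i) := fun _ => CStarAlgebra.spectralOrderedRing _
  let : PartialOrder CA := CStarAlgebra.spectralOrder _
  have : StarOrderedRing CA := CStarAlgebra.spectralOrderedRing _
  let : PartialOrder CD := CStarAlgebra.spectralOrder _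
  have : StarOrderedRing CD := CStarAlgebra.spectralOrderedRing _
  have h : IsFreeCPFamily (fun i => (hφ i).toPositiveLinearMap) embA
      (IsState.toPositiveLinearMap hprodA.condExp) (fun i => (hψ i).toPositiveLinearMap) embD
      (IsState.toPositiveLinearMap hprodD.condExp) θi :=
    { freeA := hprodA.isFreeFamily hφ
      freeD := hprodD.isFreeFamily hψ
      faithfulA := hφfaith
      cp := hcp
      map_one := hunital
      compat := hcompat }
  obtain ⟨θ, hθ, hgraph⟩ := h.exists_completelyPositive
  have hemb : ∀ i (a : A i), θ (embA i a) = embD i (θi i a) := fun i a =>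
    hgraph _ (h.emb_mem_wordGraph i a)
  refine ⟨θ, hθ, hgraph _ IsFreeCPFamily.one_mem_wordGraph, hemb, fun n ι hι a ha => ?_⟩
  have h1 := hgraph _ (wordProd_mem_wordGraph (isReducedWord_ofFn hι ha))
  simpa only [wordProd_ofFn, hemb] using h1
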